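/- arXiv:1703.03124 — 3 statements merged into one kernel-verified Lean document; each statement's English description precedes it below -/
import Mathlib

section
/- Suppose X ∈ H²(𝕋; ℝ²) satisfies |X(s₁)-X(s₂)| ≥ λ|s₁-s₂| for all s₁,s₂ ∈ 𝕋 with some λ > 0. Define g_X(s) = ∫_𝕋 Γ₀(s,s')ds' + (1/4)(-Δ)^{1/2}X(s), where Γ₀(s,s') = -∂_{s'}[G(X(s)-X(s'))](X'(s')-X'(s)) and G is the 2D Stokeslet. Then ‖g_X‖_{L^∞(𝕋)} ≤ (C/λ)·‖X'‖_{L²}·‖X''‖_{L²} for a universal constant C. -/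
open MeasureTheory Set Filter

/-- The integrand Γ₀(s,s') = -∂_{s'}[G(X(s)-X(s'))](X'(s')-X'(s)) of the boundary
velocity, written out explicitly via the 2D Stokeslet G; plane ℝ² ≅ ℂ, s' = s + τ. -/
noncomputable def Gamma0 (X X' : ℝ → ℂ) (s τ : ℝ) : ℂ :=
  (4 * Real.pi)⁻¹ •
    ((((starRingEnd ℂ (X (s + τ) - X s) * X' (s + τ)).re / ‖X (s + τ) - X s‖ ^ 2) •
        (X' (s + τ) - X' s)
      - ((starRingEnd ℂ (X (s + τ) - X s) * (X' (s + τ) - X' s)).re / ‖X (s + τ) - X s‖ ^ 2) •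
        X' (s + τ)
      - ((starRingEnd ℂ (X' (s + τ)) * (X' (s + τ) - X' s)).re / ‖X (s + τ) - X s‖ ^ 2) •
        (X (s + τ) - X s))
      + ((2 * (starRingEnd ℂ (X (s + τ) - X s) * X' (s + τ)).re *
            (starRingEnd ℂ (X (s + τ) - X s) * (X' (s + τ) - X' s)).re) /
          ‖X (s + τ) - X s‖ ^ 4) • (X (s + τ) - X s))

lemma hardy_aux (f f' : ℝ → ℂ) (hf : ∀ t, HasDerivAt f (f' t) t) (h0 : f 0 = 0)
    (a b : ℝ) (ha : a ≤ 0) (hb : 0 ≤ b)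
    (hint : IntegrableOn (fun t => ‖f' t‖ ^ 2) (Icc a b)) :
    (1/2) * (∫ t in a..b, ‖dslope f 0 t‖ ^ 2) + b * ‖dslope f 0 b‖ ^ 2 + (-a) * ‖dslope f 0 a‖ ^ 2
      ≤ 2 * ∫ t in a..b, ‖f' t‖ ^ 2 := by
  have hab : a ≤ b := ha.trans hb
  have hfc : Continuous f := continuous_iff_continuousAt.2 fun t => (hf t).continuousAt
  have hM : Continuous (dslope f 0) := by
    rw [← continuousOn_univ, continuousOn_dslope univ_mem]
    exact ⟨hfc.continuousOn, (hf 0).differentiableAt⟩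
  have hM0 : dslope f 0 0 = f' 0 := by rw [dslope_same, (hf 0).deriv]
  have hMf : ∀ t : ℝ, t • dslope f 0 t = f t := fun t => by
    have := sub_smul_dslope f 0 t
    simpa [h0] using this
  have hMn : ∀ t : ℝ, t ≠ 0 → ‖dslope f 0 t‖ = ‖f t‖ / |t| := fun t ht => by
    rw [← hMf t, norm_smul, Real.norm_eq_abs]
    field_simp
  set g : ℝ → ℝ := fun t => -(t * ‖dslope f 0 t‖ ^ 2) with hg
  have hi1 : IntervalIntegrable (fun t => ‖dslope f 0 t‖ ^ 2) volume a b :=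
    (hM.norm.pow 2).intervalIntegrable _ _
  have hi2 : IntervalIntegrable (fun t => ‖f' t‖ ^ 2) volume a b :=
    (intervalIntegrable_iff_integrableOn_Icc_of_le hab).2 hint
  have key : (∫ t in a..b, ((1/2) * ‖dslope f 0 t‖ ^ 2 - 2 * ‖f' t‖ ^ 2)) ≤ g b - g a := by
    refine intervalIntegral.integral_le_sub_of_hasDeriv_right_of_le (g := g)
      (g' := fun x => if x = 0 then -‖f' 0‖^2 else
        -((2 * inner ℝ (f x) (f' x)) * x - ‖f x‖^2 * 1) / x^2) hab ?_ ?_ ?_ ?_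
    · exact (continuous_id.mul (hM.norm.pow 2)).neg.continuousOn
    · intro x _
      apply HasDerivAt.hasDerivWithinAt
      by_cases hx : x = 0
      · subst hx
        rw [hasDerivAt_iff_tendsto_slope]
        have hc : Tendsto (fun t => -‖dslope f 0 t‖^2) (nhdsWithin 0 {0}ᶜ) (nhds (-‖f' 0‖^2)) := by
          have := ((hM.norm.pow 2).neg.tendsto 0).mono_left (nhdsWithin_le_nhds (s := {0}ᶜ))
          rw [← hM0]
          exact this
        simp only [if_true]
        refine hc.congr' ?_
        filter_upwards [self_mem_nhdsWithin] with t ht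
        have ht : t ≠ 0 := ht
        simp only [slope_def_field, hg]
        field_simp
        simp
      · have h1 : HasDerivAt (fun t => -(‖f t‖^2 / t)) (-(((2 * inner ℝ (f x) (f' x)) * x - ‖f x‖^2 * 1) / x^2)) x :=
          (((hf x).norm_sq).div (hasDerivAt_id x) hx).neg
        simp only [hx, if_false]
        rw [neg_div]
        refine h1.congr_of_eventuallyEq ?_
        filter_upwards [isOpen_ne.mem_nhds hx] with t ht
        have ht : t ≠ 0 := ht
        simp only [hg]
        rw [hMn t ht, div_pow, sq_abs]
        field_simp
    · rw [← intervalIntegrable_iff_integrableOn_Icc_of_le hab]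
      exact (hi1.const_mul _).sub (hi2.const_mul _)
    · intro x _
      by_cases hx : x = 0
      · subst hx
        simp only [if_true, hM0]
        nlinarith [sq_nonneg ‖f' 0‖]
      · simp only [hx, if_false]
        have h2 : inner ℝ (f x) (f' x) = x * inner ℝ (dslope f 0 x) (f' x) := by
          rw [← hMf x, real_inner_smul_left]
        have h3 : ‖f x‖^2 = x^2 * ‖dslope f 0 x‖^2 := by
          rw [hMn x hx, div_pow, sq_abs]; field_simp
        rw [h2, h3]
        have h4 : -(2 * (x * inner ℝ (dslope f 0 x) (f' x)) * x - x ^ 2 * ‖dslope f 0 x‖ ^ 2 * 1) / x ^ 2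
          = ‖dslope f 0 x‖^2 - 2 * inner ℝ (dslope f 0 x) (f' x) := by field_simp; ring
        rw [h4]
        have h5 := real_inner_le_norm (dslope f 0 x) (f' x)
        nlinarith [sq_nonneg (‖dslope f 0 x‖ - 2 * ‖f' x‖)]
  rw [intervalIntegral.integral_sub (hi1.const_mul _) (hi2.const_mul _),
    intervalIntegral.integral_const_mul, intervalIntegral.integral_const_mul] at key
  simp only [hg] at key
  linarith

lemma integrable_abs_rpow : IntegrableOn (fun t : ℝ => |t| ^ (-(1/2) : ℝ)) (Icc (-Real.pi) Real.pi) := by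
  have hp := Real.pi_pos
  have h1 : IntervalIntegrable (fun t : ℝ => |t| ^ (-(1/2) : ℝ)) volume 0 Real.pi := by
    have := intervalIntegral.intervalIntegrable_rpow' (a := 0) (b := Real.pi) (r := -(1/2)) (by norm_num)
    refine this.congr ?_
    intro x hx
    rw [uIoc_of_le hp.le] at hx
    simp only [abs_of_pos hx.1]
  have h2 : IntervalIntegrable (fun t : ℝ => |t| ^ (-(1/2) : ℝ)) volume (-Real.pi) 0 := by
    have := (h1.comp_sub_left 0)
    simp at this
    simpa using this.symm
  rw [← intervalIntegrable_iff_integrableOn_Icc_of_le (by linarith)]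
  exact h2.trans h1

/-- algebraic bound for the kernel -/
lemma kernel_bound (D Y V : ℂ) :
    ‖(((starRingEnd ℂ D * Y).re / ‖D‖ ^ 2) • V - ((starRingEnd ℂ D * V).re / ‖D‖ ^ 2) • Y
      - ((starRingEnd ℂ Y * V).re / ‖D‖ ^ 2) • D)
      + ((2 * (starRingEnd ℂ D * Y).re * (starRingEnd ℂ D * V).re) / ‖D‖ ^ 4) • D‖
      ≤ 5 * (‖Y‖ * ‖V‖ / ‖D‖) := by
  by_cases hD : D = 0
  · subst hD; simp
  have hD' : 0 < ‖D‖ := norm_pos_iff.2 hD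
  have hre : ∀ a b : ℂ, |(starRingEnd ℂ a * b).re| ≤ ‖a‖ * ‖b‖ := fun a b => by
    refine (Complex.abs_re_le_norm _).trans ?_
    simp
  have e1 : ‖((starRingEnd ℂ D * Y).re / ‖D‖ ^ 2) • V‖ ≤ ‖Y‖ * ‖V‖ / ‖D‖ := by
    rw [norm_smul, Real.norm_eq_abs, abs_div, abs_of_pos (pow_pos hD' 2)]
    calc _ ≤ (‖D‖ * ‖Y‖) / ‖D‖^2 * ‖V‖ := by gcongr; exact hre _ _
      _ = _ := by field_simp
  have e2 : ‖((starRingEnd ℂ D * V).re / ‖D‖ ^ 2) • Y‖ ≤ ‖Y‖ * ‖V‖ / ‖D‖ := by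
    rw [norm_smul, Real.norm_eq_abs, abs_div, abs_of_pos (pow_pos hD' 2)]
    calc _ ≤ (‖D‖ * ‖V‖) / ‖D‖^2 * ‖Y‖ := by gcongr; exact hre _ _
      _ = _ := by field_simp
  have e3 : ‖((starRingEnd ℂ Y * V).re / ‖D‖ ^ 2) • D‖ ≤ ‖Y‖ * ‖V‖ / ‖D‖ := by
    rw [norm_smul, Real.norm_eq_abs, abs_div, abs_of_pos (pow_pos hD' 2)]
    calc _ ≤ (‖Y‖ * ‖V‖) / ‖D‖^2 * ‖D‖ := by gcongr; exact hre _ _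
      _ = _ := by field_simp
  have e4 : ‖((2 * (starRingEnd ℂ D * Y).re * (starRingEnd ℂ D * V).re) / ‖D‖ ^ 4) • D‖
      ≤ 2 * (‖Y‖ * ‖V‖ / ‖D‖) := by
    rw [norm_smul, Real.norm_eq_abs, abs_div, abs_of_pos (pow_pos hD' 4), abs_mul, abs_mul,
      abs_of_pos (two_pos : (0:ℝ) < 2)]
    calc _ ≤ (2 * (‖D‖ * ‖Y‖) * (‖D‖ * ‖V‖)) / ‖D‖^4 * ‖D‖ := by
          gcongr
          · exact hre _ _
          · exact hre _ _
      _ = _ := by field_simp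
  refine (norm_add_le _ _).trans ?_
  have := norm_sub_le (((starRingEnd ℂ D * Y).re / ‖D‖ ^ 2) • V - ((starRingEnd ℂ D * V).re / ‖D‖ ^ 2) • Y) (((starRingEnd ℂ Y * V).re / ‖D‖ ^ 2) • D)
  have := norm_sub_le (((starRingEnd ℂ D * Y).re / ‖D‖ ^ 2) • V) (((starRingEnd ℂ D * V).re / ‖D‖ ^ 2) • Y)
  linarith

lemma cs_aux (K p q : ℝ) (hp : 0 ≤ p) (hq : 0 ≤ q)
    (h : ∀ θ : ℝ, 0 < θ → K ≤ θ * p^2 + q^2 / θ) : K ≤ 2 * p * q := by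
  rcases hp.eq_or_lt with rfl | hp
  · rcases hq.eq_or_lt with rfl | hq
    · simpa using h 1 one_pos
    by_contra hK
    push Not at hK
    have hK : 0 < K := by simpa using hK
    have := h (2 * q^2 / K) (by positivity)
    have e : q ^ 2 / (2 * q ^ 2 / K) = K / 2 := by field_simp
    rw [e] at this
    linarith
  · rcases hq.eq_or_lt with rfl | hq
    · by_contra hK
      push Not at hK
      have hK : 0 < K := by simpa using hK
      have := h (K / (2 * p^2)) (by positivity)
      have e : K / (2 * p^2) * p ^ 2 = K / 2 := by field_simp
      rw [e] at this
      simp at this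
      linarith
    have := h (q / p) (by positivity)
    have e : q / p * p^2 + q^2 / (q/p) = 2 * p * q := by field_simp; ring
    linarith

lemma per_integral (h : ℝ → ℝ) (hp : Function.Periodic h (2 * Real.pi)) (s : ℝ) :
    ∫ τ in (-Real.pi)..Real.pi, h (s + τ) = ∫ t in Icc 0 (2 * Real.pi), h t := by
  rw [intervalIntegral.integral_comp_add_left (f := h), integral_Icc_eq_integral_Ioc,
    ← intervalIntegral.integral_of_le (by positivity)]
  have := hp.intervalIntegral_add_eq (s + -Real.pi) 0
  rw [zero_add] at this
  rw [← this]
  congr 1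
  ring

lemma per_integrable (h : ℝ → ℝ) (hp : Function.Periodic h (2 * Real.pi)) (s : ℝ)
    (hi : IntegrableOn h (Icc 0 (2 * Real.pi))) :
    IntegrableOn (fun τ => h (s + τ)) (Icc (-Real.pi) Real.pi) := by
  have h2 := Real.two_pi_pos
  rw [← intervalIntegrable_iff_integrableOn_Icc_of_le (by positivity)] at hi
  rw [← intervalIntegrable_iff_integrableOn_Icc_of_le (by linarith)]
  have h3 : IntervalIntegrable h volume (s + -Real.pi) (s + Real.pi) :=
    hp.intervalIntegrable (t := 0) (by positivity) (by simpa using hi) _ _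
  simpa using h3.comp_add_left s

lemma per_deriv {X X' : ℝ → ℂ} {c : ℝ} (hp : Function.Periodic X c)
    (hX : ∀ t, HasDerivAt X (X' t) t) : Function.Periodic X' c := by
  intro t
  have h1 := (hX (t + c)).comp_add_const t c
  have h2 : (fun x => X (x + c)) = X := funext hp
  rw [h2] at h1
  exact h1.unique (hX t)

lemma speed_bound {X X' : ℝ → ℂ} {lam : ℝ}
    (hX : ∀ t, HasDerivAt X (X' t) t)
    (hlam : ∀ s₁ s₂ : ℝ, |s₁ - s₂| ≤ Real.pi → lam * |s₁ - s₂| ≤ ‖X s₁ - X s₂‖) (t : ℝ) :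
    lam ≤ ‖X' t‖ := by
  have h1 := (hasDerivAt_iff_tendsto_slope.1 (hX t)).norm
  refine ge_of_tendsto h1 ?_
  have hb : Metric.ball t Real.pi ∈ nhdsWithin t {t}ᶜ :=
    nhdsWithin_le_nhds (Metric.ball_mem_nhds t Real.pi_pos)
  filter_upwards [hb, self_mem_nhdsWithin] with u hu hne
  have hne : u ≠ t := hne
  have hu : |u - t| < Real.pi := by simpa [Real.dist_eq] using hu
  have h2 := hlam u t hu.le
  have h3 : 0 < |u - t| := abs_pos.2 (sub_ne_zero.2 hne)
  rw [slope_def_module, norm_smul, norm_inv, Real.norm_eq_abs, ← div_eq_inv_mul, le_div_iff₀ h3]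
  exact h2

lemma holder_aux (f f' : ℝ → ℂ) (hf : ∀ t, HasDerivAt f (f' t) t) (h0 : f 0 = 0)
    (hint : IntegrableOn (fun t => ‖f' t‖ ^ 2) (Icc (-Real.pi) Real.pi)) (τ : ℝ)
    (hτ : |τ| ≤ Real.pi) :
    ‖f τ‖ ≤ Real.sqrt (2 * |τ|) * Real.sqrt (∫ t in (-Real.pi)..Real.pi, ‖f' t‖ ^ 2) := by
  have hp := Real.pi_pos
  obtain ⟨hτ1, hτ2⟩ := abs_le.1 hτ
  have hMf : τ • dslope f 0 τ = f τ := by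
    have := sub_smul_dslope f 0 τ
    simpa [h0] using this
  have hn : ‖f τ‖ ^ 2 = |τ| * (|τ| * ‖dslope f 0 τ‖ ^ 2) := by
    rw [← hMf, norm_smul, Real.norm_eq_abs]; ring
  have hi2 : IntervalIntegrable (fun t => ‖f' t‖ ^ 2) volume (-Real.pi) Real.pi :=
    (intervalIntegrable_iff_integrableOn_Icc_of_le (by linarith)).2 hint
  have hmain : |τ| * ‖dslope f 0 τ‖ ^ 2 ≤ 2 * ∫ t in (-Real.pi)..Real.pi, ‖f' t‖ ^ 2 := by
    rcases le_total 0 τ with h | h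
    · have := hardy_aux f f' hf h0 0 τ le_rfl h (hint.mono_set (Icc_subset_Icc (by linarith) hτ2))
      have h1 : 0 ≤ ∫ t in (0:ℝ)..τ, ‖dslope f 0 t‖ ^ 2 :=
        intervalIntegral.integral_nonneg h fun _ _ => by positivity
      have h2 : ∫ t in (0:ℝ)..τ, ‖f' t‖ ^ 2 ≤ ∫ t in (-Real.pi)..Real.pi, ‖f' t‖ ^ 2 :=
        intervalIntegral.integral_mono_interval (by linarith) h hτ2
          (Eventually.of_forall fun _ => by positivity) hi2
      rw [abs_of_nonneg h]
      linarith
    · have := hardy_aux f f' hf h0 τ 0 h le_rfl (hint.mono_set (Icc_subset_Icc hτ1 (by linarith)))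
      have h1 : 0 ≤ ∫ t in τ..(0:ℝ), ‖dslope f 0 t‖ ^ 2 :=
        intervalIntegral.integral_nonneg h fun _ _ => by positivity
      have h2 : ∫ t in τ..(0:ℝ), ‖f' t‖ ^ 2 ≤ ∫ t in (-Real.pi)..Real.pi, ‖f' t‖ ^ 2 :=
        intervalIntegral.integral_mono_interval hτ1 h (by linarith)
          (Eventually.of_forall fun _ => by positivity) hi2
      rw [abs_of_nonpos h]
      linarith
  rw [← Real.sqrt_mul (by positivity)]
  apply Real.le_sqrt_of_sq_le
  rw [hn]
  nlinarith [abs_nonneg τ]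

lemma gamma_bound (X X' X'' : ℝ → ℂ) (lam : ℝ) (hl : 0 < lam)
    (hX : ∀ t, HasDerivAt X (X' t) t) (hX' : ∀ t, HasDerivAt X' (X'' t) t)
    (hlam : ∀ s₁ s₂ : ℝ, |s₁ - s₂| ≤ Real.pi → lam * |s₁ - s₂| ≤ ‖X s₁ - X s₂‖) (s : ℝ)
    (hint : IntegrableOn (fun t => ‖X'' (s + t)‖ ^ 2) (Icc (-Real.pi) Real.pi)) :
    ‖∫ τ in Icc (-Real.pi) Real.pi, Gamma0 X X' s τ‖ ≤ 5 * (4 * Real.pi)⁻¹ / lam *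
      (2 * Real.sqrt (∫ t in (-Real.pi)..Real.pi, ‖X' (s + t)‖ ^ 2) *
       Real.sqrt (∫ t in (-Real.pi)..Real.pi, ‖X'' (s + t)‖ ^ 2)) := by
  have hp := Real.pi_pos
  have hpp : -Real.pi ≤ Real.pi := by linarith
  set f : ℝ → ℂ := fun τ => X' (s + τ) - X' s with hfdef
  have hf : ∀ t, HasDerivAt f (X'' (s + t)) t := fun t =>
    ((hX' (s + t)).comp_const_add s t).sub_const _
  have h0 : f 0 = 0 := by simp [hfdef]
  have hXc : Continuous X' := continuous_iff_continuousAt.2 fun t => (hX' t).continuousAt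
  have hfc : Continuous f := continuous_iff_continuousAt.2 fun t => (hf t).continuousAt
  have hM : Continuous (dslope f 0) := by
    rw [← continuousOn_univ, continuousOn_dslope univ_mem]
    exact ⟨hfc.continuousOn, (hf 0).differentiableAt⟩
  have hMf : ∀ t : ℝ, t • dslope f 0 t = f t := fun t => by
    have := sub_smul_dslope f 0 t
    simpa [h0] using this
  have hXs : Continuous fun t => X' (s + t) := hXc.comp (continuous_const.add continuous_id)
  have hpt : ∀ τ ∈ Icc (-Real.pi) Real.pi, ‖Gamma0 X X' s τ‖ ≤
      5 * (4 * Real.pi)⁻¹ / lam * (‖X' (s + τ)‖ * ‖dslope f 0 τ‖) := by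
    intro τ hτ
    have hk := kernel_bound (X (s + τ) - X s) (X' (s + τ)) (X' (s + τ) - X' s)
    unfold Gamma0
    rw [norm_smul, Real.norm_eq_abs, abs_of_pos (by positivity)]
    have hq : ‖X' (s + τ)‖ * ‖X' (s + τ) - X' s‖ / ‖X (s + τ) - X s‖ ≤
        ‖X' (s + τ)‖ * ‖dslope f 0 τ‖ / lam := by
      have e1 : ‖X' (s + τ) - X' s‖ = |τ| * ‖dslope f 0 τ‖ := by
        have := hMf τ
        rw [← Real.norm_eq_abs, ← norm_smul, this]
      have hd := hlam (s + τ) s (by simpa using abs_le.2 hτ)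
      have hd : lam * |τ| ≤ ‖X (s + τ) - X s‖ := by simpa using hd
      by_cases ht : τ = 0
      · subst ht; simp; positivity
      have ht' : 0 < |τ| := abs_pos.2 ht
      have : 0 < lam * |τ| := by positivity
      rw [e1]
      calc _ ≤ ‖X' (s + τ)‖ * (|τ| * ‖dslope f 0 τ‖) / (lam * |τ|) := by gcongr
        _ = _ := by field_simp
    calc _ ≤ (4 * Real.pi)⁻¹ * (5 * (‖X' (s + τ)‖ * ‖dslope f 0 τ‖ / lam)) := by
          gcongr
          exact hk.trans (by gcongr)
      _ = _ := by ring
  have hcont : Continuous fun τ => ‖X' (s + τ)‖ * ‖dslope f 0 τ‖ := hXs.norm.mul hM.norm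
  have h1 : ‖∫ τ in Icc (-Real.pi) Real.pi, Gamma0 X X' s τ‖ ≤
      ∫ τ in Icc (-Real.pi) Real.pi,
        5 * (4 * Real.pi)⁻¹ / lam * (‖X' (s + τ)‖ * ‖dslope f 0 τ‖) := by
    apply norm_integral_le_of_norm_le
    · exact (hcont.const_mul _).continuousOn.integrableOn_Icc
    · exact (ae_restrict_iff' measurableSet_Icc).2 (Eventually.of_forall hpt)
  rw [integral_const_mul] at h1
  refine h1.trans ?_
  refine mul_le_mul_of_nonneg_left ?_ (by positivity)
  rw [integral_Icc_eq_integral_Ioc, ← intervalIntegral.integral_of_le hpp]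
  have hA : 0 ≤ ∫ t in (-Real.pi)..Real.pi, ‖X' (s + t)‖ ^ 2 :=
    intervalIntegral.integral_nonneg hpp fun _ _ => by positivity
  have hB : 0 ≤ ∫ t in (-Real.pi)..Real.pi, ‖X'' (s + t)‖ ^ 2 :=
    intervalIntegral.integral_nonneg hpp fun _ _ => by positivity
  apply cs_aux _ _ _ (Real.sqrt_nonneg _) (Real.sqrt_nonneg _)
  intro θ hθ
  rw [Real.sq_sqrt hA, Real.sq_sqrt hB]
  have hH := hardy_aux f _ hf h0 (-Real.pi) Real.pi (by linarith) hp.le hint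
  have hH2 : ∫ t in (-Real.pi)..Real.pi, ‖dslope f 0 t‖ ^ 2 ≤
      4 * ∫ t in (-Real.pi)..Real.pi, ‖X'' (s + t)‖ ^ 2 := by
    have : 0 ≤ Real.pi * ‖dslope f 0 Real.pi‖ ^ 2 := by positivity
    have : 0 ≤ - -Real.pi * ‖dslope f 0 (-Real.pi)‖ ^ 2 := by rw [neg_neg]; positivity
    linarith
  have i1 : IntervalIntegrable (fun t => θ * ‖X' (s + t)‖ ^ 2) volume (-Real.pi) Real.pi :=
    (continuous_const.mul (hXs.norm.pow 2)).intervalIntegrable _ _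
  have i2 : IntervalIntegrable (fun t => (4 * θ)⁻¹ * ‖dslope f 0 t‖ ^ 2) volume
      (-Real.pi) Real.pi :=
    (continuous_const.mul (hM.norm.pow 2)).intervalIntegrable _ _
  have hmono := intervalIntegral.integral_mono_on hpp (hcont.intervalIntegrable _ _) (i1.add i2)
    (fun x _ => by
      have : θ * ‖X' (s + x)‖ ^ 2 + (4 * θ)⁻¹ * ‖dslope f 0 x‖ ^ 2
        - ‖X' (s + x)‖ * ‖dslope f 0 x‖ =
        (4 * θ)⁻¹ * (2 * θ * ‖X' (s + x)‖ - ‖dslope f 0 x‖) ^ 2 := by field_simp; ring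
      have h' : 0 ≤ (4 * θ)⁻¹ * (2 * θ * ‖X' (s + x)‖ - ‖dslope f 0 x‖) ^ 2 := by positivity
      linarith)
  rw [intervalIntegral.integral_add i1 i2, intervalIntegral.integral_const_mul,
    intervalIntegral.integral_const_mul] at hmono
  refine hmono.trans ?_
  gcongr
  calc _ ≤ (4 * θ)⁻¹ * (4 * ∫ t in (-Real.pi)..Real.pi, ‖X'' (s + t)‖ ^ 2) := by gcongr
    _ = _ := by field_simp

lemma lambda_bound (X X' X'' : ℝ → ℂ)
    (hX : ∀ t, HasDerivAt X (X' t) t) (hX' : ∀ t, HasDerivAt X' (X'' t) t) (s : ℝ)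
    (hint : IntegrableOn (fun t => ‖X'' (s + t)‖ ^ 2) (Icc (-Real.pi) Real.pi))
    (ε : ℝ) (hε : 0 < ε) :
    ‖∫ τ in {τ : ℝ | ε ≤ |τ| ∧ |τ| ≤ Real.pi},
        (4 * Real.sin (τ / 2) ^ 2)⁻¹ • (X (s + τ) - X s)‖ ≤
      (Real.pi ^ 2 / 4 * Real.sqrt 2 * ∫ t in Icc (-Real.pi) Real.pi, |t| ^ (-(1/2) : ℝ)) *
       Real.sqrt (∫ t in (-Real.pi)..Real.pi, ‖X'' (s + t)‖ ^ 2) := by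
  have hp := Real.pi_pos
  set B := Real.sqrt (∫ t in (-Real.pi)..Real.pi, ‖X'' (s + t)‖ ^ 2) with hB
  have hB0 : 0 ≤ B := Real.sqrt_nonneg _
  set S : Set ℝ := {τ : ℝ | ε ≤ |τ| ∧ |τ| ≤ Real.pi} with hS
  have hSsub : S ⊆ Icc (-Real.pi) Real.pi := fun τ h => abs_le.1 h.2
  have hSclosed : IsClosed S :=
    (isClosed_le continuous_const continuous_abs).inter (isClosed_le continuous_abs continuous_const)
  have hScomp : IsCompact S := isCompact_Icc.of_isClosed_subset hSclosed hSsub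
  have hSm : MeasurableSet S := hSclosed.measurableSet
  have hsin : ∀ τ ∈ S, τ ^ 2 / Real.pi ^ 2 ≤ Real.sin (τ / 2) ^ 2 := by
    intro τ hτ
    have h1 := Real.mul_abs_le_abs_sin (x := τ / 2)
      (by rw [abs_div, abs_two]; linarith [hτ.2])
    rw [abs_div, abs_two] at h1
    have h2 : |τ| / Real.pi ≤ |Real.sin (τ / 2)| := by
      refine le_trans (le_of_eq ?_) h1
      field_simp
    have h3 := pow_le_pow_left₀ (by positivity) h2 2
    rwa [div_pow, sq_abs, sq_abs] at h3
  have hpos : ∀ τ ∈ S, 0 < τ ^ 2 := fun τ hτ => by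
    have : 0 < |τ| := hε.trans_le hτ.1
    have : τ ≠ 0 := abs_pos.1 this
    positivity
  have hw : ContinuousOn (fun τ : ℝ => (4 * Real.sin (τ / 2) ^ 2)⁻¹) S := by
    apply ContinuousOn.inv₀
    · fun_prop
    · intro τ hτ
      have h1 := hsin τ hτ
      have h2 : 0 < τ ^ 2 / Real.pi ^ 2 := div_pos (hpos τ hτ) (by positivity)
      exact (by linarith : 0 < 4 * Real.sin (τ / 2) ^ 2).ne'
  have hXc : Continuous X := continuous_iff_continuousAt.2 fun t => (hX t).continuousAt
  have hi1 : IntegrableOn (fun τ : ℝ => (4 * Real.sin (τ / 2) ^ 2)⁻¹ •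
      (X (s + τ) - X s - τ • X' s)) S := by
    refine ContinuousOn.integrableOn_compact hScomp ?_
    exact hw.smul (Continuous.continuousOn (by fun_prop))
  have hi2 : IntegrableOn (fun τ : ℝ => (4 * Real.sin (τ / 2) ^ 2)⁻¹ • (τ • X' s)) S := by
    refine ContinuousOn.integrableOn_compact hScomp ?_
    exact hw.smul (Continuous.continuousOn (by fun_prop))
  have hodd : ∫ τ in S, (4 * Real.sin (τ / 2) ^ 2)⁻¹ • (τ • X' s) = 0 := by
    rw [← integral_indicator hSm]
    have h1 := integral_neg_eq_self
      (S.indicator (fun τ : ℝ => (4 * Real.sin (τ / 2) ^ 2)⁻¹ • (τ • X' s))) volume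
    have h2 : ∀ x : ℝ,
        S.indicator (fun τ : ℝ => (4 * Real.sin (τ / 2) ^ 2)⁻¹ • (τ • X' s)) (-x) =
        - S.indicator (fun τ : ℝ => (4 * Real.sin (τ / 2) ^ 2)⁻¹ • (τ • X' s)) x := by
      intro x
      have hmem : -x ∈ S ↔ x ∈ S := by simp [hS]
      by_cases hx : x ∈ S
      · rw [indicator_of_mem hx, indicator_of_mem (hmem.2 hx)]
        simp [neg_div]
      · rw [indicator_of_notMem hx, indicator_of_notMem (fun h => hx (hmem.1 h))]
        simp
    simp only [h2] at h1
    rw [integral_neg] at h1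
    exact self_eq_neg.1 h1.symm
  have hsplit : ∫ τ in S, (4 * Real.sin (τ / 2) ^ 2)⁻¹ • (X (s + τ) - X s) =
      ∫ τ in S, (4 * Real.sin (τ / 2) ^ 2)⁻¹ • (X (s + τ) - X s - τ • X' s) := by
    have : ∀ τ : ℝ, (4 * Real.sin (τ / 2) ^ 2)⁻¹ • (X (s + τ) - X s) =
      (4 * Real.sin (τ / 2) ^ 2)⁻¹ • (X (s + τ) - X s - τ • X' s) +
      (4 * Real.sin (τ / 2) ^ 2)⁻¹ • (τ • X' s) := fun τ => by
        rw [← smul_add, sub_add_cancel]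
    simp only [this]
    rw [integral_add hi1 hi2, hodd, add_zero]
  rw [hsplit]
  -- second order Taylor bound
  have hTay : ∀ τ : ℝ, |τ| ≤ Real.pi →
      ‖X (s + τ) - X s - τ • X' s‖ ≤ Real.sqrt (2 * |τ|) * B * |τ| := by
    intro τ hτ
    have hh : ∀ t : ℝ, HasDerivAt (fun t : ℝ => X (s + t) - t • X' s) (X' (s + t) - X' s) t := by
      intro t
      have := ((hX (s + t)).comp_const_add s t).sub ((hasDerivAt_id t).smul_const (X' s))
      rw [one_smul] at this
      exact this
    have := (convex_uIcc (0:ℝ) τ).norm_image_sub_le_of_norm_hasDerivWithin_le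
      (f := fun t : ℝ => X (s + t) - t • X' s) (f' := fun t => X' (s + t) - X' s)
      (C := Real.sqrt (2 * |τ|) * B) (x := 0) (y := τ)
      (fun t _ => (hh t).hasDerivWithinAt)
      (fun t ht => by
        have hle : |t| ≤ |τ| := by simpa using abs_sub_left_of_mem_uIcc ht
        have := holder_aux (fun t => X' (s + t) - X' s) (fun t => X'' (s + t))
          (fun t => ((hX' (s + t)).comp_const_add s t).sub_const _) (by simp) hint t (hle.trans hτ)
        refine this.trans ?_
        rw [← hB]
        gcongr)
      left_mem_uIcc right_mem_uIcc
    simp only [add_zero, zero_smul, sub_zero, Real.norm_eq_abs] at this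
    have e : X (s + τ) - X s - τ • X' s = X (s + τ) - τ • X' s - X s := by ring
    rw [e]
    exact this
  have hK : IntegrableOn (fun t : ℝ => Real.pi ^ 2 / 4 * Real.sqrt 2 * B * |t| ^ (-(1/2) : ℝ))
      (Icc (-Real.pi) Real.pi) := integrable_abs_rpow.const_mul _
  calc _ ≤ ∫ t in S, Real.pi ^ 2 / 4 * Real.sqrt 2 * B * |t| ^ (-(1/2) : ℝ) := by
        apply norm_integral_le_of_norm_le (hK.mono_set hSsub)
        refine (ae_restrict_iff' hSm).2 (Eventually.of_forall fun τ hτ => ?_)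
        have ht : 0 < |τ| := hε.trans_le hτ.1
        have h1 := hTay τ hτ.2
        have h2 := hsin τ hτ
        have h3 : 0 < τ ^ 2 / Real.pi ^ 2 := div_pos (hpos τ hτ) (by positivity)
        rw [norm_smul, norm_inv, Real.norm_eq_abs, abs_of_nonneg (by positivity)]
        calc _ ≤ (4 * (τ ^ 2 / Real.pi ^ 2))⁻¹ * (Real.sqrt (2 * |τ|) * B * |τ|) := by
              gcongr
          _ = _ := by
              rw [Real.rpow_neg ht.le, ← Real.sqrt_eq_rpow, Real.sqrt_mul (by norm_num), ← sq_abs τ]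
              have hs : 0 < Real.sqrt |τ| := Real.sqrt_pos.2 ht
              have e : Real.sqrt |τ| ^ 2 = |τ| := Real.sq_sqrt ht.le
              field_simp
              rw [e]
    _ ≤ ∫ t in Icc (-Real.pi) Real.pi, Real.pi ^ 2 / 4 * Real.sqrt 2 * B * |t| ^ (-(1/2) : ℝ) := by
        apply setIntegral_mono_set hK
        · exact Eventually.of_forall fun t => by simp only [Pi.zero_apply]; positivity
        · exact hSsub.eventuallyLE
    _ = _ := by rw [integral_const_mul]; ring

/-- L^∞ bound for g_X(s) = ∫ Γ₀(s,s') ds' + (1/4)(-Δ)^{1/2}X(s): it is bounded by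
(C/λ)‖X'‖_{L²}‖X''‖_{L²}.  Λ denotes the half-Laplacian (-Δ)^{1/2}X given as the
principal value of its singular-integral representation. -/
theorem gX_Linfty_bound :
    ∃ C : ℝ, 0 < C ∧
      ∀ (X X' X'' : ℝ → ℂ) (lam : ℝ) (Λ : ℝ → ℂ), 0 < lam →
        Function.Periodic X (2 * Real.pi) →
        (∀ t, HasDerivAt X (X' t) t) →
        (∀ t, HasDerivAt X' (X'' t) t) →
        IntegrableOn (fun t => ‖X'' t‖ ^ 2) (Icc 0 (2 * Real.pi)) →
        (∀ s₁ s₂ : ℝ, |s₁ - s₂| ≤ Real.pi → lam * |s₁ - s₂| ≤ ‖X s₁ - X s₂‖) →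
        (∀ s : ℝ, Tendsto
            (fun ε : ℝ => (-(Real.pi)⁻¹ : ℝ) •
              ∫ τ in {τ : ℝ | ε ≤ |τ| ∧ |τ| ≤ Real.pi},
                (4 * Real.sin (τ / 2) ^ 2)⁻¹ • (X (s + τ) - X s))
            (nhdsWithin 0 (Ioi 0)) (nhds (Λ s))) →
        ∀ s : ℝ,
          ‖(∫ τ in Icc (-Real.pi) Real.pi, Gamma0 X X' s τ) + (4 : ℝ)⁻¹ • Λ s‖ ≤
            C / lam * (∫ t in Icc 0 (2 * Real.pi), ‖X' t‖ ^ 2) ^ ((1 : ℝ) / 2) *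
              (∫ t in Icc 0 (2 * Real.pi), ‖X'' t‖ ^ 2) ^ ((1 : ℝ) / 2) := by
  have hp := Real.pi_pos
  set K : ℝ := Real.pi ^ 2 / 4 * Real.sqrt 2 * ∫ t in Icc (-Real.pi) Real.pi, |t| ^ (-(1/2) : ℝ)
    with hKdef
  have hK : 0 ≤ K := by
    have : 0 ≤ ∫ t in Icc (-Real.pi) Real.pi, |t| ^ (-(1/2) : ℝ) :=
      integral_nonneg fun t => by positivity
    positivity
  refine ⟨5 * (4 * Real.pi)⁻¹ * 2 + 4⁻¹ * (Real.pi⁻¹ * K), by positivity, ?_⟩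
  intro X X' X'' lam Λ hl hper hX hX' hint hlam hΛ s
  have hper' := per_deriv hper hX
  have hper'' := per_deriv hper' hX'
  have hpA : Function.Periodic (fun t => ‖X' t‖ ^ 2) (2 * Real.pi) := fun t => by
    simp only [hper' t]
  have hpB : Function.Periodic (fun t => ‖X'' t‖ ^ 2) (2 * Real.pi) := fun t => by
    simp only [hper'' t]
  have hints := per_integrable _ hpB s hint
  have hG := gamma_bound X X' X'' lam hl hX hX' hlam s hints
  have hL := lambda_bound X X' X'' hX hX' s hints
  rw [per_integral _ hpA s, per_integral _ hpB s] at hG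
  rw [per_integral _ hpB s] at hL
  rw [← Real.sqrt_eq_rpow, ← Real.sqrt_eq_rpow]
  have hXc : Continuous X' := continuous_iff_continuousAt.2 fun t => (hX' t).continuousAt
  have hA : lam ≤ Real.sqrt (∫ t in Icc 0 (2 * Real.pi), ‖X' t‖ ^ 2) := by
    apply Real.le_sqrt_of_sq_le
    have h1 : ∫ t in Icc 0 (2 * Real.pi), lam ^ 2 ≤ ∫ t in Icc 0 (2 * Real.pi), ‖X' t‖ ^ 2 := by
      apply setIntegral_mono_on
      · exact continuous_const.continuousOn.integrableOn_Icc
      · exact (hXc.norm.pow 2).continuousOn.integrableOn_Icc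
      · exact measurableSet_Icc
      · intro t _
        have := speed_bound hX hlam t
        gcongr
    rw [setIntegral_const, smul_eq_mul, Real.volume_real_Icc_of_le (by positivity)] at h1
    nlinarith [Real.pi_gt_three, sq_nonneg lam]
  set A := Real.sqrt (∫ t in Icc 0 (2 * Real.pi), ‖X' t‖ ^ 2)
  set B := Real.sqrt (∫ t in Icc 0 (2 * Real.pi), ‖X'' t‖ ^ 2)
  have hB0 : 0 ≤ B := Real.sqrt_nonneg _
  have hLam : ‖Λ s‖ ≤ Real.pi⁻¹ * (K * B) := by
    refine le_of_tendsto (hΛ s).norm ?_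
    filter_upwards [self_mem_nhdsWithin] with ε hε
    rw [norm_smul, norm_neg, norm_inv, Real.norm_eq_abs, abs_of_pos hp]
    have := hL ε hε
    gcongr
  have hBA : B ≤ A * B / lam := by
    rw [le_div_iff₀ hl]
    nlinarith
  calc _ ≤ _ := norm_add_le _ _
    _ ≤ 5 * (4 * Real.pi)⁻¹ / lam * (2 * A * B) + 4⁻¹ * (Real.pi⁻¹ * (K * (A * B / lam))) := by
        rw [norm_smul, norm_inv, Real.norm_eq_abs, abs_of_pos (by norm_num : (0:ℝ) < 4)]
        have := hLam.trans (show Real.pi⁻¹ * (K * B) ≤ Real.pi⁻¹ * (K * (A * B / lam)) by gcongr)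
        gcongr
    _ = _ := by ring
end

section
/- Let Y ∈ H¹(𝕋; ℝ²) define a Jordan curve with effective radius R_Y and let Y_* be its closest equilibrium configuration. Then (1/2)(‖Y'‖²_{L²} - ‖Y_*'‖²_{L²}) ≤ ‖Y' - Y_*'‖²_{L²} ≤ 4(‖Y'‖²_{L²} - ‖Y_*'‖²_{L²}). In particular the elastic energy difference and the squared Ḣ¹-distance to the closest equilibrium are comparable. -/
open MeasureTheory Set

lemma wirt (f f' : ℝ → ℂ) (hper : f (2 * Real.pi) = f 0)
    (hd : ∀ t, HasDerivAt f (f' t) t) (hf' : Continuous f')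
    (h0 : ∫ s in (0 : ℝ)..(2 * Real.pi), f s = 0) :
    ∫ s in (0 : ℝ)..(2 * Real.pi), ‖f s‖ ^ 2 ≤ ∫ s in (0 : ℝ)..(2 * Real.pi), ‖f' s‖ ^ 2 := by
  have hab : (0 : ℝ) < 2 * Real.pi := by positivity
  have hf : Continuous f := continuous_iff_continuousAt.2 fun t => (hd t).continuousAt
  have mem : ∀ g : ℝ → ℂ, Continuous g →
      MemLp g 2 (volume.restrict (Ioc 0 (2 * Real.pi))) := by
    intro g hg
    have hK : IsCompact (Icc (0 : ℝ) (2 * Real.pi)) := isCompact_Icc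
    obtain ⟨C, hC⟩ := hK.exists_bound_of_continuousOn hg.continuousOn
    refine MemLp.of_bound hg.aestronglyMeasurable C ?_
    refine (ae_restrict_iff' measurableSet_Ioc).2 (Filter.Eventually.of_forall fun x hx => ?_)
    exact hC x ⟨hx.1.le, hx.2⟩
  have S1 := hasSum_sq_fourierCoeffOn hab (mem f hf)
  have S2 := hasSum_sq_fourierCoeffOn hab (mem f' hf')
  have key : ∀ n : ℤ, ‖fourierCoeffOn hab f n‖ ^ 2 ≤ ‖fourierCoeffOn hab f' n‖ ^ 2 := by
    intro n
    by_cases hn : n = 0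
    · subst hn
      have : fourierCoeffOn hab f 0 = 0 := by
        rw [fourierCoeffOn_eq_integral]
        simp [h0]
      rw [this]; simp
    · have h := fourierCoeffOn_of_hasDerivAt hab hn (fun x _ => hd x)
        (hf'.intervalIntegrable _ _)
      rw [h, hper]
      gcongr
      have hn1 : (1 : ℝ) ≤ |(n : ℝ)| := by exact_mod_cast Int.one_le_abs hn
      have : ‖(1 / (-2 * Real.pi * Complex.I * n) : ℂ)‖ * (2 * Real.pi) ≤ 1 := by
        simp only [norm_div, norm_mul, norm_neg, norm_one, Complex.norm_I, Complex.norm_real,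
          Complex.norm_intCast, Complex.norm_ofNat, Real.norm_eq_abs, abs_of_pos Real.pi_pos]
        have := Real.pi_pos
        rw [div_mul_eq_mul_div, div_le_one (by positivity)]
        nlinarith
      have h2 : ‖(((2 * Real.pi : ℝ) : ℂ) - ((0:ℝ):ℂ))‖ = 2 * Real.pi := by
        rw [← Complex.ofReal_sub, Complex.norm_real, sub_zero, Real.norm_eq_abs, abs_of_pos hab]
      rw [norm_mul, sub_self, mul_zero, zero_sub, norm_neg, norm_mul, h2, ← mul_assoc]
      exact mul_le_of_le_one_left (norm_nonneg _) this
  have := hasSum_le key S1 S2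
  simp only [smul_eq_mul, sub_zero] at this
  exact le_of_mul_le_mul_left this (by positivity)

lemma re_int (G : ℝ → ℂ) (hG : Continuous G) :
    ∫ s in (0 : ℝ)..(2 * Real.pi), (G s).re = (∫ s in (0 : ℝ)..(2 * Real.pi), G s).re :=
  Complex.reCLM.intervalIntegral_comp_comm (hG.intervalIntegrable _ _)

lemma im_int (G : ℝ → ℂ) (hG : Continuous G) :
    ∫ s in (0 : ℝ)..(2 * Real.pi), (G s).im = (∫ s in (0 : ℝ)..(2 * Real.pi), G s).im :=
  Complex.imCLM.intervalIntegral_comp_comm (hG.intervalIntegrable _ _)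

lemma nsq (z : ℂ) : ‖z‖ ^ 2 = z.re * z.re + z.im * z.im := by
  rw [← Complex.normSq_eq_norm_sq, Complex.normSq_apply]

/-- The unit circle parametrization. -/
noncomputable def ue (θ : ℝ) (s : ℝ) : ℂ := Complex.exp (((s + θ : ℝ) : ℂ) * Complex.I)

lemma ue_d (θ s : ℝ) : HasDerivAt (ue θ) (Complex.I * ue θ s) s := by
  unfold ue
  have h1 : HasDerivAt (fun s : ℝ => ((s + θ : ℝ) : ℂ) * Complex.I) (1 * Complex.I) s := by
    have := ((hasDerivAt_id s).add_const θ).ofReal_comp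
    simpa using this.mul_const Complex.I
  convert h1.cexp using 1
  ring

lemma ue_c (θ : ℝ) : Continuous (ue θ) :=
  continuous_iff_continuousAt.2 fun t => (ue_d θ t).continuousAt

lemma ue_per (θ : ℝ) : ue θ (2 * Real.pi) = ue θ 0 := by
  unfold ue
  rw [Complex.exp_eq_exp_iff_exists_int]
  exact ⟨1, by push_cast; ring⟩

lemma ue_n (θ s : ℝ) : ‖ue θ s‖ = 1 := Complex.norm_exp_ofReal_mul_I _

lemma ue_n2 (θ s : ℝ) : (ue θ s).re * (ue θ s).re + (ue θ s).im * (ue θ s).im = 1 := by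
  rw [← nsq, ue_n]; norm_num

lemma ue_cm (θ s : ℝ) : starRingEnd ℂ (ue θ s) * ue θ s = 1 := by
  rw [mul_comm, Complex.mul_conj, Complex.normSq_eq_norm_sq, ue_n]; simp

lemma ue_split (θ s : ℝ) : ue θ s = Complex.exp (θ * Complex.I) * ue 0 s := by
  unfold ue
  rw [← Complex.exp_add]; congr 1; push_cast; ring

lemma ftc (f f' : ℝ → ℂ) (hper : f (2 * Real.pi) = f 0)
    (hd : ∀ t, HasDerivAt f (f' t) t) (hf' : Continuous f') :
    ∫ s in (0 : ℝ)..(2 * Real.pi), f' s = 0 := by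
  rw [intervalIntegral.integral_eq_sub_of_hasDerivAt (fun t _ => hd t)
    (hf'.intervalIntegrable _ _), hper, sub_self]

lemma ue_int (θ : ℝ) : ∫ s in (0 : ℝ)..(2 * Real.pi), ue θ s = 0 := by
  have := ftc _ _ (ue_per θ) (ue_d θ) (continuous_const.mul (ue_c θ))
  rw [intervalIntegral.integral_const_mul] at this
  simpa using this

lemma conj_d (f f' : ℝ → ℂ) (t : ℝ) (h : HasDerivAt f (f' t) t) :
    HasDerivAt (fun s => starRingEnd ℂ (f s)) (starRingEnd ℂ (f' t)) t :=
  (Complex.conjCLE.toContinuousLinearMap.hasFDerivAt.comp_hasDerivAt t h)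

lemma ii {E : Type*} [NormedAddCommGroup E] {f : ℝ → E} (hf : Continuous f) :
    IntervalIntegrable f volume (0 : ℝ) (2 * Real.pi) := hf.intervalIntegrable _ _

/-- Expansion of the distance to a candidate equilibrium. -/
lemma expand (Y : ℝ → ℂ) (hY : Continuous Y) (R θ : ℝ) (x : ℂ) :
    ∫ s in (0 : ℝ)..(2 * Real.pi), ‖Y s - (x + (R : ℂ) * ue θ s)‖ ^ 2
      = (∫ s in (0 : ℝ)..(2 * Real.pi), ‖Y s‖ ^ 2) + 2 * Real.pi * (‖x‖ ^ 2 + R ^ 2)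
        - 2 * (starRingEnd ℂ x * ∫ s in (0 : ℝ)..(2 * Real.pi), Y s).re
        - 2 * R * (starRingEnd ℂ (Complex.exp (θ * Complex.I)) *
          ∫ s in (0 : ℝ)..(2 * Real.pi), starRingEnd ℂ (ue 0 s) * Y s).re := by
  have c1 := ue_c θ
  have c0 := ue_c 0
  have cc0 : Continuous fun s => starRingEnd ℂ (ue 0 s) := Complex.continuous_conj.comp c0
  have e1 : ∀ s, ‖Y s - (x + (R : ℂ) * ue θ s)‖ ^ 2 = ‖Y s‖ ^ 2 + ((‖x‖ ^ 2 + R ^ 2)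
      + 2 * ((starRingEnd ℂ x * R * ue θ s - starRingEnd ℂ x * Y s
        - R * starRingEnd ℂ (Complex.exp (θ * Complex.I)) * (starRingEnd ℂ (ue 0 s) * Y s)).re)) := by
    intro s
    have : starRingEnd ℂ (Complex.exp (θ * Complex.I)) * (starRingEnd ℂ (ue 0 s) * Y s)
      = starRingEnd ℂ (ue θ s) * Y s := by
      rw [ue_split θ s, map_mul]; ring
    rw [mul_assoc (R : ℂ), this]
    have h := ue_n2 θ s
    simp only [nsq, Complex.sub_re, Complex.sub_im, Complex.add_re, Complex.add_im, Complex.mul_re,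
      Complex.mul_im, Complex.ofReal_re, Complex.ofReal_im, Complex.conj_re, Complex.conj_im]
    linear_combination R ^ 2 * h
  simp_rw [e1]
  have cG : Continuous fun s => (starRingEnd ℂ x * R * ue θ s - starRingEnd ℂ x * Y s
        - R * starRingEnd ℂ (Complex.exp (θ * Complex.I)) * (starRingEnd ℂ (ue 0 s) * Y s)) := by
    fun_prop
  rw [intervalIntegral.integral_add (ii (by fun_prop)) (ii (by fun_prop)),
    intervalIntegral.integral_add (ii (by fun_prop)) (ii (by fun_prop)),
    intervalIntegral.integral_const_mul, re_int _ cG,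
    intervalIntegral.integral_sub (ii (by fun_prop)) (ii (by fun_prop)),
    intervalIntegral.integral_sub (ii (by fun_prop)) (ii (by fun_prop)),
    intervalIntegral.integral_const_mul, intervalIntegral.integral_const_mul,
    intervalIntegral.integral_const_mul, ue_int, intervalIntegral.integral_const]
  rw [mul_assoc (R : ℂ)]
  simp only [mul_zero, zero_sub, Complex.sub_re, Complex.neg_re, Complex.re_ofReal_mul,
    smul_eq_mul]
  ring

/-- Optimality: mean and first Fourier mode. -/
lemma opt (Y : ℝ → ℂ) (hY : Continuous Y) (R θs : ℝ) (xs : ℂ) (hR : 0 < R)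
    (hmin : ∀ (θ : ℝ) (x : ℂ),
      (∫ s in (0 : ℝ)..(2 * Real.pi), ‖Y s - (xs + (R : ℂ) * ue θs s)‖ ^ 2)
        ≤ ∫ s in (0 : ℝ)..(2 * Real.pi), ‖Y s - (x + (R : ℂ) * ue θ s)‖ ^ 2) :
    (∫ s in (0 : ℝ)..(2 * Real.pi), Y s) = 2 * Real.pi * xs ∧
    ∃ r : ℝ, 0 ≤ r ∧ (∫ s in (0 : ℝ)..(2 * Real.pi), starRingEnd ℂ (ue θs s) * Y s)
      = 2 * Real.pi * r := by
  have hpi := Real.pi_pos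
  simp_rw [expand Y hY] at hmin
  set M := ∫ s in (0 : ℝ)..(2 * Real.pi), Y s with hM
  set C := ∫ s in (0 : ℝ)..(2 * Real.pi), starRingEnd ℂ (ue 0 s) * Y s with hC
  constructor
  · obtain ⟨m, hm⟩ : ∃ m : ℂ, M = ((2 * Real.pi : ℝ) : ℂ) * m :=
      ⟨M / ((2 * Real.pi : ℝ) : ℂ), by field_simp⟩
    have h := hmin θs m
    rw [hm] at h ⊢
    have h2 : (xs.re - m.re) ^ 2 + (xs.im - m.im) ^ 2 ≤ 0 := by
      simp only [nsq, Complex.mul_re, Complex.mul_im, Complex.conj_re, Complex.conj_im,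
        Complex.ofReal_re, Complex.ofReal_im] at h
      have : 2 * Real.pi * ((xs.re - m.re) ^ 2 + (xs.im - m.im) ^ 2) ≤ 0 := by linarith
      by_contra hc
      push Not at hc
      have := mul_pos (mul_pos two_pos hpi) hc
      linarith
    have h3 : xs.re - m.re = 0 := by nlinarith [sq_nonneg (xs.re - m.re), sq_nonneg (xs.im - m.im)]
    have h4 : xs.im - m.im = 0 := by nlinarith [sq_nonneg (xs.re - m.re), sq_nonneg (xs.im - m.im)]
    have : xs = m := Complex.ext (by linarith) (by linarith)
    rw [this]; push_cast; ring
  · have e : (∫ s in (0 : ℝ)..(2 * Real.pi), starRingEnd ℂ (ue θs s) * Y s)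
        = starRingEnd ℂ (Complex.exp (θs * Complex.I)) * C := by
      rw [hC, ← intervalIntegral.integral_const_mul]
      congr 1; ext s; rw [ue_split θs s, map_mul]; ring
    rw [e]
    have h := hmin C.arg xs
    have hc : starRingEnd ℂ (Complex.exp (C.arg * Complex.I)) * C = (‖C‖ : ℂ) := by
      have h1 := Complex.norm_mul_exp_arg_mul_I C
      have h2 := ue_cm C.arg 0
      simp only [ue, zero_add] at h2
      nth_rewrite 2 [← h1]
      linear_combination (‖C‖ : ℂ) * h2
    rw [hc] at h
    set w := starRingEnd ℂ (Complex.exp (θs * Complex.I)) * C with hw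
    have hwn : ‖w‖ = ‖C‖ := by
      rw [hw, norm_mul, RCLike.norm_conj, Complex.norm_exp_ofReal_mul_I, one_mul]
    rw [Complex.ofReal_re, ← hwn] at h
    have h5 : ‖w‖ ≤ w.re := by
      have : R * ‖w‖ ≤ R * w.re := by linarith
      exact le_of_mul_le_mul_left this hR
    have h6 : w.re = ‖w‖ := le_antisymm (Complex.re_le_norm w) h5
    have h7 : w.im = 0 := by
      have := nsq w
      rw [← h6] at this
      nlinarith
    refine ⟨‖w‖ / (2 * Real.pi), by positivity, ?_⟩
    push_cast
    rw [mul_div_cancel₀ _ (by exact_mod_cast (mul_pos two_pos hpi).ne')]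
    exact Complex.ext (by simpa using h6) (by simpa using h7)

/-- Inequalities for the remainder, which has no modes 0 and 1. -/
lemma core (Z Z' : ℝ → ℂ) (θ : ℝ) (hper : Z (2 * Real.pi) = Z 0)
    (hd : ∀ t, HasDerivAt Z (Z' t) t) (hZ' : Continuous Z')
    (h0 : ∫ s in (0 : ℝ)..(2 * Real.pi), Z s = 0)
    (h1 : ∫ s in (0 : ℝ)..(2 * Real.pi), starRingEnd ℂ (ue θ s) * Z s = 0) :
    2 * (∫ s in (0 : ℝ)..(2 * Real.pi), (starRingEnd ℂ (Z s) * Z' s).im)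
      ≤ ∫ s in (0 : ℝ)..(2 * Real.pi), ‖Z' s‖ ^ 2 ∧
    -(∫ s in (0 : ℝ)..(2 * Real.pi), (starRingEnd ℂ (Z s) * Z' s).im)
      ≤ ∫ s in (0 : ℝ)..(2 * Real.pi), ‖Z' s‖ ^ 2 := by
  have hZ : Continuous Z := continuous_iff_continuousAt.2 fun t => (hd t).continuousAt
  have hcZ : Continuous fun s => starRingEnd ℂ (Z s) := Complex.continuous_conj.comp hZ
  have hcu : Continuous fun s => starRingEnd ℂ (ue θ s) := Complex.continuous_conj.comp (ue_c θ)
  have cP : Continuous fun s => (starRingEnd ℂ (Z s) * Z' s).im :=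
    Complex.continuous_im.comp (hcZ.mul hZ')
  have w1 := wirt Z Z' hper hd hZ' h0
  have w2 := wirt (fun s => starRingEnd ℂ (ue θ s) * Z s)
    (fun s => starRingEnd ℂ (Complex.I * ue θ s) * Z s + starRingEnd ℂ (ue θ s) * Z' s)
    (by simp only [hper, ue_per])
    (fun t => (conj_d (ue θ) (fun s => Complex.I * ue θ s) t (ue_d θ t)).mul (hd t))
    (by simp only [map_mul]; fun_prop) h1
  have e1 : ∀ s, ‖starRingEnd ℂ (ue θ s) * Z s‖ ^ 2 = ‖Z s‖ ^ 2 := by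
    intro s; rw [norm_mul, RCLike.norm_conj, ue_n, one_mul]
  have e2 : ∀ s, ‖starRingEnd ℂ (Complex.I * ue θ s) * Z s + starRingEnd ℂ (ue θ s) * Z' s‖ ^ 2
      = ‖Z' s‖ ^ 2 + (‖Z s‖ ^ 2 - 2 * (starRingEnd ℂ (Z s) * Z' s).im) := by
    intro s
    have : starRingEnd ℂ (Complex.I * ue θ s) * Z s + starRingEnd ℂ (ue θ s) * Z' s
      = starRingEnd ℂ (ue θ s) * (Z' s - Complex.I * Z s) := by
      rw [map_mul, Complex.conj_I]; ring
    rw [this, norm_mul, RCLike.norm_conj, ue_n, one_mul]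
    simp only [nsq, Complex.sub_re, Complex.sub_im, Complex.mul_re,
      Complex.mul_im, Complex.I_re, Complex.I_im, Complex.conj_re, Complex.conj_im]
    ring
  simp_rw [e1, e2] at w2
  rw [intervalIntegral.integral_add (ii (by fun_prop)) (ii (by fun_prop)),
    intervalIntegral.integral_sub (ii (by fun_prop)) (ii (by fun_prop)),
    intervalIntegral.integral_const_mul] at w2
  have w3 : 0 ≤ ∫ s in (0 : ℝ)..(2 * Real.pi),
      (‖Z' s‖ ^ 2 + (‖Z s‖ ^ 2 + 2 * (starRingEnd ℂ (Z s) * Z' s).im)) := by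
    refine intervalIntegral.integral_nonneg (by positivity) fun s _ => ?_
    have : ‖Z' s‖ ^ 2 + (‖Z s‖ ^ 2 + 2 * (starRingEnd ℂ (Z s) * Z' s).im)
        = ‖Z' s + Complex.I * Z s‖ ^ 2 := by
      simp only [nsq, Complex.add_re, Complex.add_im, Complex.mul_re,
        Complex.mul_im, Complex.I_re, Complex.I_im, Complex.conj_re, Complex.conj_im]
      ring
    rw [this]; positivity
  rw [intervalIntegral.integral_add (ii (by fun_prop)) (ii (by fun_prop)),
    intervalIntegral.integral_add (ii (by fun_prop)) (ii (by fun_prop)),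
    intervalIntegral.integral_const_mul] at w3
  constructor <;> linarith

/-- Pythagoras for a function orthogonal to the first mode. -/
lemma pyth (F : ℝ → ℂ) (hF : Continuous F) (θ a : ℝ)
    (h1 : ∫ s in (0 : ℝ)..(2 * Real.pi), starRingEnd ℂ (ue θ s) * F s = 0) :
    ∫ s in (0 : ℝ)..(2 * Real.pi), ‖F s + a * Complex.I * ue θ s‖ ^ 2
      = (∫ s in (0 : ℝ)..(2 * Real.pi), ‖F s‖ ^ 2) + 2 * Real.pi * a ^ 2 := by
  have hcu : Continuous fun s => starRingEnd ℂ (ue θ s) := Complex.continuous_conj.comp (ue_c θ)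
  have cG : Continuous fun s => starRingEnd ℂ (ue θ s) * F s := hcu.mul hF
  have cI : Continuous fun s => (starRingEnd ℂ (ue θ s) * F s).im :=
    Complex.continuous_im.comp cG
  have e : ∀ s, ‖F s + a * Complex.I * ue θ s‖ ^ 2
      = ‖F s‖ ^ 2 + (a ^ 2 + 2 * a * (starRingEnd ℂ (ue θ s) * F s).im) := by
    intro s
    have h := ue_n2 θ s
    simp only [nsq, Complex.add_re, Complex.add_im, Complex.mul_re,
      Complex.mul_im, Complex.I_re, Complex.I_im, Complex.conj_re, Complex.conj_im,
      Complex.ofReal_re, Complex.ofReal_im]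
    linear_combination a ^ 2 * h
  simp_rw [e]
  rw [intervalIntegral.integral_add (ii (by fun_prop)) (ii (by fun_prop)),
    intervalIntegral.integral_add (ii (by fun_prop)) (ii (by fun_prop)),
    intervalIntegral.integral_const_mul, im_int _ cG, h1, intervalIntegral.integral_const]
  simp

lemma final (Y Y' : ℝ → ℂ) (R θs : ℝ) (xs : ℂ)
    (hY : Continuous Y) (hper : Y (2 * Real.pi) = Y 0)
    (hd : ∀ t, HasDerivAt Y (Y' t) t) (hY' : Continuous Y')
    (hR : 0 < R)
    (harea : (1 / 2) * (∫ s in (0 : ℝ)..(2 * Real.pi), (starRingEnd ℂ (Y s) * Y' s).im)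
        = Real.pi * R ^ 2)
    (hmin : ∀ (θ : ℝ) (x : ℂ),
      (∫ s in (0 : ℝ)..(2 * Real.pi), ‖Y s - (xs + (R : ℂ) * ue θs s)‖ ^ 2)
        ≤ ∫ s in (0 : ℝ)..(2 * Real.pi), ‖Y s - (x + (R : ℂ) * ue θ s)‖ ^ 2) :
    (1 / 2) * ((∫ s in (0 : ℝ)..(2 * Real.pi), ‖Y' s‖ ^ 2)
        - ∫ s in (0 : ℝ)..(2 * Real.pi), ‖(R : ℂ) * Complex.I * ue θs s‖ ^ 2)
      ≤ (∫ s in (0 : ℝ)..(2 * Real.pi), ‖Y' s - (R : ℂ) * Complex.I * ue θs s‖ ^ 2)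
    ∧ (∫ s in (0 : ℝ)..(2 * Real.pi), ‖Y' s - (R : ℂ) * Complex.I * ue θs s‖ ^ 2)
      ≤ 4 * ((∫ s in (0 : ℝ)..(2 * Real.pi), ‖Y' s‖ ^ 2)
        - ∫ s in (0 : ℝ)..(2 * Real.pi), ‖(R : ℂ) * Complex.I * ue θs s‖ ^ 2) := by
  have hpi := Real.pi_pos
  obtain ⟨hM, r, hr, hC⟩ := opt Y hY R θs xs hR hmin
  have cu := ue_c θs
  have ccu : Continuous fun s => starRingEnd ℂ (ue θs s) := Complex.continuous_conj.comp cu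
  obtain ⟨Z, hZ⟩ : ∃ Z : ℝ → ℂ, ∀ s, Z s = Y s - (xs + r * ue θs s) := ⟨_, fun _ => rfl⟩
  obtain ⟨Z', hZ'⟩ : ∃ Z' : ℝ → ℂ, ∀ s, Z' s = Y' s - r * Complex.I * ue θs s :=
    ⟨_, fun _ => rfl⟩
  have dZ : ∀ t, HasDerivAt Z (Z' t) t := by
    intro t
    rw [funext hZ, hZ']
    have := (hd t).sub (((ue_d θs t).const_mul (r : ℂ)).const_add xs)
    rw [← mul_assoc] at this
    exact this
  have cZ : Continuous Z := continuous_iff_continuousAt.2 fun t => (dZ t).continuousAt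
  have cZ' : Continuous Z' := by rw [funext hZ']; fun_prop
  have ccZ : Continuous fun s => starRingEnd ℂ (Z s) := Complex.continuous_conj.comp cZ
  have pZ : Z (2 * Real.pi) = Z 0 := by rw [hZ, hZ, hper, ue_per]
  have hconst : ∀ c : ℂ, ∫ s in (0 : ℝ)..(2 * Real.pi), c = 2 * Real.pi * c := by
    intro c; rw [intervalIntegral.integral_const]; simp
  have icu : ∫ s in (0 : ℝ)..(2 * Real.pi), starRingEnd ℂ (ue θs s) = 0 := by
    have h := ftc _ _ (by simp only [ue_per])
      (fun t => conj_d (ue θs) (fun s => Complex.I * ue θs s) t (ue_d θs t))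
      (by simp only [map_mul]; fun_prop)
    simp only [map_mul] at h
    rw [intervalIntegral.integral_const_mul] at h
    simpa using h
  have Z0 : ∫ s in (0 : ℝ)..(2 * Real.pi), Z s = 0 := by
    simp_rw [hZ]
    rw [intervalIntegral.integral_sub (ii (by fun_prop)) (ii (by fun_prop)),
      intervalIntegral.integral_add (ii (by fun_prop)) (ii (by fun_prop)),
      intervalIntegral.integral_const_mul, ue_int, hM, hconst]
    ring
  have Z1 : ∫ s in (0 : ℝ)..(2 * Real.pi), starRingEnd ℂ (ue θs s) * Z s = 0 := by
    have e : ∀ s, starRingEnd ℂ (ue θs s) * Z s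
        = starRingEnd ℂ (ue θs s) * Y s - (xs * starRingEnd ℂ (ue θs s) + r) := by
      intro s
      rw [hZ]
      linear_combination (-(r : ℂ)) * ue_cm θs s
    simp_rw [e]
    rw [intervalIntegral.integral_sub (ii (by fun_prop)) (ii (by fun_prop)),
      intervalIntegral.integral_add (ii (by fun_prop)) (ii (by fun_prop)),
      intervalIntegral.integral_const_mul, icu, hC, hconst]
    ring
  have intdZa : ∫ s in (0 : ℝ)..(2 * Real.pi), Z' s = 0 := ftc Z Z' pZ dZ cZ'
  have intdZb : ∫ s in (0 : ℝ)..(2 * Real.pi), starRingEnd ℂ (ue θs s) * Z' s = 0 := by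
    have h := ftc (fun s => starRingEnd ℂ (ue θs s) * Z s)
      (fun s => starRingEnd ℂ (Complex.I * ue θs s) * Z s + starRingEnd ℂ (ue θs s) * Z' s)
      (by simp only [pZ, ue_per])
      (fun t => (conj_d (ue θs) (fun s => Complex.I * ue θs s) t (ue_d θs t)).mul (dZ t))
      (by simp only [map_mul]; fun_prop)
    simp only [map_mul, mul_assoc] at h
    rw [intervalIntegral.integral_add (ii (by fun_prop)) (ii (by fun_prop)),
      intervalIntegral.integral_const_mul, Z1, mul_zero, zero_add] at h
    exact h
  obtain ⟨k1, k2⟩ := core Z Z' θs pZ dZ cZ' Z0 Z1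
  have A1 : ∫ s in (0 : ℝ)..(2 * Real.pi), ‖Y' s‖ ^ 2
      = (∫ s in (0 : ℝ)..(2 * Real.pi), ‖Z' s‖ ^ 2) + 2 * Real.pi * r ^ 2 := by
    rw [← pyth Z' cZ' θs r intdZb]
    congr 1; ext s; rw [hZ', sub_add_cancel]
  have A2 : ∫ s in (0 : ℝ)..(2 * Real.pi), ‖Y' s - (R : ℂ) * Complex.I * ue θs s‖ ^ 2
      = (∫ s in (0 : ℝ)..(2 * Real.pi), ‖Z' s‖ ^ 2) + 2 * Real.pi * (r - R) ^ 2 := by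
    rw [← pyth Z' cZ' θs (r - R) intdZb]
    congr 1; ext s; rw [hZ']; push_cast; congr 2; ring
  have A3 : ∫ s in (0 : ℝ)..(2 * Real.pi), ‖(R : ℂ) * Complex.I * ue θs s‖ ^ 2
      = 2 * Real.pi * R ^ 2 := by
    simp [ue_n]
  have A4 : ∫ s in (0 : ℝ)..(2 * Real.pi), (starRingEnd ℂ (Y s) * Y' s).im
      = (∫ s in (0 : ℝ)..(2 * Real.pi), (starRingEnd ℂ (Z s) * Z' s).im)
        + 2 * Real.pi * r ^ 2 := by
    have cP : Continuous fun s => (starRingEnd ℂ (Z s) * Z' s).im :=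
      Complex.continuous_im.comp (ccZ.mul cZ')
    have cG : Continuous fun s => starRingEnd ℂ xs * Z' s
        + (starRingEnd ℂ xs * r * Complex.I * ue θs s
        + (r * (starRingEnd ℂ (ue θs s) * Z' s)
        + r * Complex.I * (starRingEnd ℂ (ue θs s) * Z s))) := by fun_prop
    have e : ∀ s, (starRingEnd ℂ (Y s) * Y' s).im = (starRingEnd ℂ (Z s) * Z' s).im + (r ^ 2
        + (starRingEnd ℂ xs * Z' s
        + (starRingEnd ℂ xs * r * Complex.I * ue θs s
        + (r * (starRingEnd ℂ (ue θs s) * Z' s)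
        + r * Complex.I * (starRingEnd ℂ (ue θs s) * Z s)))).im) := by
      intro s
      have y1 : Y s = Z s + (xs + r * ue θs s) := by rw [hZ]; ring
      have y2 : Y' s = Z' s + r * Complex.I * ue θs s := by rw [hZ']; ring
      have h := ue_n2 θs s
      rw [y1, y2]
      simp only [Complex.add_re, Complex.add_im, Complex.mul_re,
        Complex.mul_im, Complex.I_re, Complex.I_im, Complex.conj_re, Complex.conj_im,
        Complex.ofReal_re, Complex.ofReal_im]
      linear_combination r ^ 2 * h
    simp_rw [e]
    have cGi := Complex.continuous_im.comp cG
    simp only [Function.comp_def] at cGi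
    rw [intervalIntegral.integral_add (ii cP) (ii (by fun_prop)),
      intervalIntegral.integral_add (ii (by fun_prop)) (ii cGi), im_int _ cG,
      intervalIntegral.integral_add (ii (by fun_prop)) (ii (by fun_prop)),
      intervalIntegral.integral_add (ii (by fun_prop)) (ii (by fun_prop)),
      intervalIntegral.integral_add (ii (by fun_prop)) (ii (by fun_prop)),
      intervalIntegral.integral_const_mul, intervalIntegral.integral_const_mul,
      intervalIntegral.integral_const_mul, intervalIntegral.integral_const_mul,
      intdZa, intdZb, Z1, ue_int, intervalIntegral.integral_const]
    simp
  rw [A4] at harea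
  rw [A1, A2, A3]
  set Q := ∫ s in (0 : ℝ)..(2 * Real.pi), ‖Z' s‖ ^ 2
  set P := ∫ s in (0 : ℝ)..(2 * Real.pi), (starRingEnd ℂ (Z s) * Z' s).im
  have hP : P = 2 * Real.pi * R ^ 2 - 2 * Real.pi * r ^ 2 := by linarith
  have hQ : 0 ≤ Q := by linarith
  have hrR : 0 ≤ Real.pi * (r - R) ^ 2 := by positivity
  have t1 : 0 ≤ Real.pi * r * R := by positivity
  have t2 : 0 ≤ Real.pi * R ^ 2 := by positivity
  have t3 : 0 ≤ Real.pi * r ^ 2 := by positivity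
  have hpos : 2 * Real.pi * (r - R) ^ 2 ≤ |P| := by
    rw [hP]
    rcases le_total r R with h | h
    · refine le_trans ?_ (le_abs_self _)
      have := mul_nonneg (mul_nonneg hpi.le hr) (sub_nonneg.2 h)
      nlinarith
    · refine le_trans ?_ (neg_le_abs _)
      have := mul_nonneg (mul_nonneg hpi.le hR.le) (sub_nonneg.2 h)
      nlinarith
  have hPQ : |P| ≤ Q - P := abs_le.2 ⟨by linarith, by linarith⟩
  constructor
  · nlinarith
  · nlinarith

theorem energy_difference_comparable_H1 (Y Y' : ℝ → ℂ) (R θs : ℝ) (xs : ℂ)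
    (hY : Continuous Y) (hper : Function.Periodic Y (2 * Real.pi))
    (hd : ∀ t, HasDerivAt Y (Y' t) t) (hY' : Continuous Y')
    (hR : 0 < R)
    (hinj : ∀ s₁ ∈ Ico (0 : ℝ) (2 * Real.pi), ∀ s₂ ∈ Ico (0 : ℝ) (2 * Real.pi),
      Y s₁ = Y s₂ → s₁ = s₂)
    (harea : (1 / 2) * (∫ s in (0 : ℝ)..(2 * Real.pi), (starRingEnd ℂ (Y s) * Y' s).im)
        = Real.pi * R ^ 2)
    (hmin : ∀ (θ : ℝ) (x : ℂ),
      (∫ s in (0 : ℝ)..(2 * Real.pi),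
          ‖Y s - (xs + (R : ℂ) * Complex.exp (((s + θs : ℝ) : ℂ) * Complex.I))‖ ^ 2)
        ≤ ∫ s in (0 : ℝ)..(2 * Real.pi),
          ‖Y s - (x + (R : ℂ) * Complex.exp (((s + θ : ℝ) : ℂ) * Complex.I))‖ ^ 2) :
    (1 / 2) * ((∫ s in (0 : ℝ)..(2 * Real.pi), ‖Y' s‖ ^ 2)
        - ∫ s in (0 : ℝ)..(2 * Real.pi),
            ‖(R : ℂ) * Complex.I * Complex.exp (((s + θs : ℝ) : ℂ) * Complex.I)‖ ^ 2)
      ≤ (∫ s in (0 : ℝ)..(2 * Real.pi),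
          ‖Y' s - (R : ℂ) * Complex.I * Complex.exp (((s + θs : ℝ) : ℂ) * Complex.I)‖ ^ 2)
    ∧ (∫ s in (0 : ℝ)..(2 * Real.pi),
          ‖Y' s - (R : ℂ) * Complex.I * Complex.exp (((s + θs : ℝ) : ℂ) * Complex.I)‖ ^ 2)
      ≤ 4 * ((∫ s in (0 : ℝ)..(2 * Real.pi), ‖Y' s‖ ^ 2)
        - ∫ s in (0 : ℝ)..(2 * Real.pi),
            ‖(R : ℂ) * Complex.I * Complex.exp (((s + θs : ℝ) : ℂ) * Complex.I)‖ ^ 2) := by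
  exact final Y Y' R θs xs hY (by simpa using hper 0) hd hY' hR harea hmin
end

section
/- Let X_*(s) = (cos s, sin s)ᵀ and D ∈ H^{5/2}(𝕋;ℝ²). The linearization of the boundary velocity of the 2D Stokes immersed boundary problem around the unit circle, evaluated in direction D, equals −(1/4)J·(ℋD)(s) − (1/4)(ℋD')(s), where J = [[0,1],[−1,0]] and ℋ is the Hilbert transform on 𝕋. Equivalently, the term ∫_𝕋 −ln|X_*(s')−X_*(s)| D''(s') ds'/(4π) equals −(1/4)ℋD'(s). -/
open MeasureTheory Set Filter

/-- The 2D Stokeslet G(x) = (1/4π)(-ln|x| Id + x⊗x/|x|²) applied to a vector v,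
with the plane ℝ² identified with ℂ. -/
noncomputable def stokeslet (x v : ℂ) : ℂ :=
  (4 * Real.pi)⁻¹ •
    ((-Real.log ‖x‖) • v + ((‖x‖ ^ 2)⁻¹ * (starRingEnd ℂ x * v).re) • x)


lemma periodic_of_hasDerivAt {f f' : ℝ → ℂ} {T : ℝ} (hper : Function.Periodic f T)
    (hd : ∀ t, HasDerivAt f (f' t) t) : Function.Periodic f' T := by
  intro t
  have h1 : HasDerivAt (fun u => f (u + T)) (f' (t + T)) t := (hd (t + T)).comp_add_const t T
  have h2 : (fun u => f (u + T)) = f := funext hper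
  rw [h2] at h1
  exact h1.unique (hd t)

lemma abs_sin_half_periodic : Function.Periodic (fun τ : ℝ => |Real.sin (τ / 2)|) (2 * Real.pi) := by
  intro τ
  have : (τ + 2 * Real.pi) / 2 = τ / 2 + Real.pi := by ring
  simp only [this, Real.sin_add_pi, abs_neg]

lemma cot_half_periodic :
    Function.Periodic (fun τ : ℝ => Real.cos (τ / 2) / Real.sin (τ / 2)) (2 * Real.pi) := by
  intro τ
  have : (τ + 2 * Real.pi) / 2 = τ / 2 + Real.pi := by ring
  simp only [this, Real.sin_add_pi, Real.cos_add_pi, neg_div_neg_eq]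

lemma lip_sin {f f' : ℝ → ℂ} (hper : Function.Periodic f (2 * Real.pi))
    (hd : ∀ t, HasDerivAt f (f' t) t) (hc : Continuous f') (s : ℝ) :
    ∃ C : ℝ, 0 ≤ C ∧ ∀ τ, ‖f (s + τ) - f s‖ ≤ C * |Real.sin (τ / 2)| := by
  obtain ⟨L, hL⟩ := (isCompact_Icc (a := s - Real.pi) (b := s + Real.pi)).exists_bound_of_continuousOn
    hc.continuousOn
  have hpi := Real.pi_pos
  have hL0 : 0 ≤ L := (norm_nonneg _).trans (hL s ⟨by linarith, by linarith⟩)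
  refine ⟨L * Real.pi, by positivity, ?_⟩
  intro τ
  have hp : Function.Periodic
      (fun τ : ℝ => (f (s + τ), |Real.sin (τ / 2)|)) (2 * Real.pi) := by
    intro τ
    have h1 := abs_sin_half_periodic τ
    simp only at h1
    simp only [h1, ← add_assoc, hper _]
  obtain ⟨y, hy, hy2⟩ := hp.exists_mem_Ico (by positivity) τ (-Real.pi)
  simp only [Prod.mk.injEq] at hy2
  rw [hy2.1, hy2.2]
  have hy1 : |y| ≤ Real.pi := abs_le.2 ⟨hy.1, by linarith [hy.2]⟩
  have hyy := abs_le.1 hy1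
  have h1 := Convex.norm_image_sub_le_of_norm_hasDerivWithin_le
    (fun x _ => (hd x).hasDerivWithinAt) hL (convex_Icc _ _)
    (show s ∈ Icc (s - Real.pi) (s + Real.pi) from ⟨by linarith, by linarith⟩)
    (show s + y ∈ Icc (s - Real.pi) (s + Real.pi) from ⟨by linarith, by linarith⟩)
  have h2 := @Real.mul_abs_le_abs_sin (y / 2) (by rw [abs_div, abs_two]; linarith)
  have h3 : |y| ≤ Real.pi * |Real.sin (y / 2)| := by
    rw [abs_div, abs_two, div_mul_div_comm, div_le_iff₀ (by positivity)] at h2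
    linarith
  calc _ ≤ L * ‖s + y - s‖ := h1
    _ = L * |y| := by simp
    _ ≤ L * (Real.pi * |Real.sin (y / 2)|) := by gcongr
    _ = _ := by ring

lemma measurable_cot_half : Measurable (fun τ : ℝ => Real.cos (τ / 2) / Real.sin (τ / 2)) := by
  fun_prop

lemma cot_bound {f : ℝ → ℂ} {s C : ℝ} (hC : 0 ≤ C)
    (h : ∀ τ, ‖f (s + τ) - f s‖ ≤ C * |Real.sin (τ / 2)|) (τ : ℝ) :
    ‖(Real.cos (τ / 2) / Real.sin (τ / 2)) • (f (s + τ) - f s)‖ ≤ C := by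
  rw [norm_smul, norm_div, Real.norm_eq_abs, Real.norm_eq_abs]
  by_cases h0 : Real.sin (τ / 2) = 0
  · simp [h0, hC]
  have h1 : 0 < |Real.sin (τ / 2)| := abs_pos.2 h0
  calc _ ≤ 1 / |Real.sin (τ / 2)| * (C * |Real.sin (τ / 2)|) := by
        gcongr
        · exact Real.abs_cos_le_one _
        · exact h τ
    _ = C := by field_simp

lemma cot_integrable {f : ℝ → ℂ} {s C : ℝ} (hf : Continuous f) (hC : 0 ≤ C)
    (h : ∀ τ, ‖f (s + τ) - f s‖ ≤ C * |Real.sin (τ / 2)|) (a b : ℝ) :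
    IntervalIntegrable (fun τ => (Real.cos (τ / 2) / Real.sin (τ / 2)) • (f (s + τ) - f s))
      volume a b := by
  have hm : Measurable (fun τ => (Real.cos (τ / 2) / Real.sin (τ / 2)) • (f (s + τ) - f s)) := by
    apply Measurable.smul measurable_cot_half
    exact ((hf.comp (continuous_const.add continuous_id)).sub continuous_const).measurable
  refine (intervalIntegrable_const (c := C)).mono_fun hm.aestronglyMeasurable ?_
  refine Eventually.of_forall fun τ => ?_
  rw [Real.norm_of_nonneg hC]
  exact cot_bound hC h τ

lemma pv_eq {f : ℝ → ℂ} (hper : Function.Periodic f (2 * Real.pi)) {s C : ℝ}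
    (hf : Continuous f) (hC : 0 ≤ C)
    (h : ∀ τ, ‖f (s + τ) - f s‖ ≤ C * |Real.sin (τ / 2)|) {H : ℂ}
    (hH : Tendsto (fun ε : ℝ => (-(2 * Real.pi)⁻¹ : ℝ) •
        ∫ τ in {τ : ℝ | ε ≤ |τ| ∧ |τ| ≤ Real.pi},
          (Real.cos (τ / 2) / Real.sin (τ / 2)) • f (s + τ))
      (nhdsWithin 0 (Ioi 0)) (nhds H)) :
    ∫ τ in (0 : ℝ)..(2 * Real.pi), (Real.cos (τ / 2) / Real.sin (τ / 2)) • (f (s + τ) - f s)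
      = (-(2 * Real.pi)) • H := by
  have hpi := Real.pi_pos
  set g : ℝ → ℂ := fun τ => (Real.cos (τ / 2) / Real.sin (τ / 2)) • (f (s + τ) - f s) with hg
  have hgper : Function.Periodic g (2 * Real.pi) := by
    intro τ
    have h1 := cot_half_periodic τ
    simp only at h1
    simp only [hg, h1, ← add_assoc, hper _]
  have hshift : ∫ τ in (0 : ℝ)..(2 * Real.pi), g τ = ∫ τ in Ioc (-Real.pi) Real.pi, g τ := by
    have := hgper.intervalIntegral_add_eq 0 (-Real.pi)
    rw [zero_add, show -Real.pi + 2 * Real.pi = Real.pi by ring] at this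
    rw [this, intervalIntegral.integral_of_le (by linarith)]
  have hgi : IntegrableOn g (Icc (-Real.pi) Real.pi) := by
    have := cot_integrable hf hC h (-Real.pi) Real.pi
    rwa [intervalIntegrable_iff_integrableOn_Icc_of_le (by linarith)] at this
  have hSm : ∀ ε : ℝ, MeasurableSet {τ : ℝ | ε ≤ |τ| ∧ |τ| ≤ Real.pi} := by
    intro ε
    apply IsClosed.measurableSet
    exact (isClosed_le continuous_const continuous_abs).inter
      (isClosed_le continuous_abs continuous_const)
  have hSsub : ∀ ε : ℝ, {τ : ℝ | ε ≤ |τ| ∧ |τ| ≤ Real.pi} ⊆ Icc (-Real.pi) Real.pi :=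
    fun ε τ hτ => abs_le.1 hτ.2
  have hSeq : ∀ ε : ℝ, 0 < ε → ∫ τ in {τ : ℝ | ε ≤ |τ| ∧ |τ| ≤ Real.pi},
          (Real.cos (τ / 2) / Real.sin (τ / 2)) • f (s + τ)
        = ∫ τ in {τ : ℝ | ε ≤ |τ| ∧ |τ| ≤ Real.pi}, g τ := by
    intro ε hε
    set S := {τ : ℝ | ε ≤ |τ| ∧ |τ| ≤ Real.pi} with hS
    have hcomp : IsCompact S := by
      apply isCompact_Icc.of_isClosed_subset _ (hSsub ε)
      exact (isClosed_le continuous_const continuous_abs).inter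
        (isClosed_le continuous_abs continuous_const)
    have hodd : ∫ τ in S, (Real.cos (τ / 2) / Real.sin (τ / 2)) • f s = 0 := by
      rw [← integral_indicator (hSm ε)]
      set k := S.indicator (fun τ : ℝ => (Real.cos (τ / 2) / Real.sin (τ / 2)) • f s)
      have h1 : ∀ x, k (-x) = - k x := by
        intro x
        have hx : -x ∈ S ↔ x ∈ S := by simp [hS]
        by_cases hxS : x ∈ S
        · simp only [k, indicator_of_mem hxS, indicator_of_mem (hx.2 hxS), neg_div,
            Real.cos_neg, Real.sin_neg, div_neg, neg_smul]
        · simp only [k, indicator_of_notMem hxS, indicator_of_notMem (mt hx.1 hxS), neg_zero]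
      have h2 := integral_neg_eq_self k volume
      simp only [h1, integral_neg] at h2
      exact self_eq_neg.1 h2.symm
    have hcoti : IntegrableOn (fun τ : ℝ => (Real.cos (τ / 2) / Real.sin (τ / 2)) • f s) S := by
      apply ContinuousOn.integrableOn_compact hcomp
      refine ContinuousOn.fun_smul ?_ continuousOn_const
      apply ContinuousOn.div (by fun_prop) (by fun_prop)
      intro τ hτ h0
      have h2 := @Real.mul_abs_le_abs_sin (τ / 2) (by rw [abs_div, abs_two]; linarith [hτ.2])
      rw [h0, abs_zero, abs_div, abs_two] at h2
      have h3 : 0 < 2 / Real.pi * (|τ| / 2) := by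
        have : 0 < |τ| := hε.trans_le hτ.1
        positivity
      linarith
    rw [← add_zero (∫ τ in S, g τ), ← hodd, ← integral_add (hgi.mono_set (hSsub ε)) hcoti]
    congr 1
    ext τ
    simp only [hg]
    rw [← smul_add, sub_add_cancel]
  have hlim : Tendsto (fun ε : ℝ => ∫ τ in {τ : ℝ | ε ≤ |τ| ∧ |τ| ≤ Real.pi}, g τ)
      (nhdsWithin 0 (Ioi 0)) (nhds (∫ τ in Icc (-Real.pi) Real.pi, g τ)) := by
    simp_rw [← integral_indicator (hSm _), ← integral_indicator (measurableSet_Icc (α := ℝ))]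
    apply tendsto_integral_filter_of_dominated_convergence
      ((Icc (-Real.pi) Real.pi).indicator fun τ => ‖g τ‖)
    · refine Eventually.of_forall fun ε => ?_
      rw [aestronglyMeasurable_indicator_iff (hSm ε)]
      exact (hgi.mono_set (hSsub ε)).aestronglyMeasurable
    · refine Eventually.of_forall fun ε => Eventually.of_forall fun τ => ?_
      rw [norm_indicator_eq_indicator_norm]
      exact indicator_le_indicator_of_subset (hSsub ε) (fun _ => norm_nonneg _) τ
    · rw [integrable_indicator_iff measurableSet_Icc]
      exact hgi.norm
    · refine Eventually.of_forall fun τ => ?_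
      by_cases h0 : τ = 0
      · subst h0
        have : g 0 = 0 := by simp [hg]
        simp only [indicator_apply, this, ite_self]
        exact tendsto_const_nhds
      · apply tendsto_const_nhds.congr'
        have : ∀ᶠ ε in nhdsWithin (0 : ℝ) (Ioi 0), ε < |τ| :=
          nhdsWithin_le_nhds (gt_mem_nhds (abs_pos.2 h0))
        filter_upwards [this] with ε hε
        simp [indicator_apply, hε.le, abs_le]
  have hlim2 := hlim.const_smul (-(2 * Real.pi)⁻¹ : ℝ)
  have hEq : H = (-(2 * Real.pi)⁻¹ : ℝ) • ∫ τ in Icc (-Real.pi) Real.pi, g τ := by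
    apply tendsto_nhds_unique hH
    apply hlim2.congr'
    filter_upwards [self_mem_nhdsWithin] with ε hε
    rw [hSeq ε hε]
  rw [hshift, ← integral_Icc_eq_integral_Ioc, hEq, smul_smul]
  rw [show -(2 * Real.pi) * -(2 * Real.pi)⁻¹ = 1 by field_simp, one_smul]

lemma log_integrable (a b : ℝ) :
    IntervalIntegrable (fun τ : ℝ => Real.log (2 * Real.sin (τ / 2))) volume a b := by
  have h1 : IntervalIntegrable (fun τ : ℝ => Real.log (Real.sin (2⁻¹ * τ))) volume a b := by
    have := (intervalIntegrable_log_sin (a := 2⁻¹ * a) (b := 2⁻¹ * b)).comp_mul_left (c := 2⁻¹)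
      (by simp) (by simp)
    have e : ∀ x : ℝ, 2⁻¹ * x / 2⁻¹ = x := fun x => by ring
    rw [e, e] at this
    exact this
  have h2 := (intervalIntegrable_const (c := Real.log 2) (a := a) (b := b)
    (μ := volume)).add h1
  refine h2.congr_ae ?_
  have hz : ∀ᵐ τ : ℝ ∂volume, Real.sin (τ / 2) ≠ 0 := by
    have : {τ : ℝ | Real.sin (τ / 2) = 0}.Countable := by
      have : {τ : ℝ | Real.sin (τ / 2) = 0} ⊆ range (fun n : ℤ => 2 * (n * Real.pi)) := by
        intro τ hτ
        obtain ⟨n, hn⟩ := Real.sin_eq_zero_iff.1 hτ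
        exact ⟨n, by simp only [hn]; ring⟩
      exact (countable_range _).mono this
    have := this.measure_zero volume
    rw [ae_iff]
    simpa using this
  filter_upwards [ae_restrict_of_ae hz] with τ hτ
  rw [Real.log_mul two_ne_zero hτ, div_eq_inv_mul]

lemma log_parts {f f' : ℝ → ℂ} {s C : ℝ} (hd : ∀ t, HasDerivAt f (f' t) t) (hc : Continuous f')
    (hC : 0 ≤ C)
    (h : ∀ τ, ‖f (s + τ) - f s‖ ≤ C * |Real.sin (τ / 2)|) :
    ∫ τ in (0 : ℝ)..(2 * Real.pi), (-Real.log (2 * Real.sin (τ / 2))) • f' (s + τ)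
      = (2 : ℝ)⁻¹ • ∫ τ in (0 : ℝ)..(2 * Real.pi),
        (Real.cos (τ / 2) / Real.sin (τ / 2)) • (f (s + τ) - f s) := by
  have hpi := Real.pi_pos
  have hf : Continuous f := continuous_iff_continuousAt.2 fun t => (hd t).continuousAt
  have hi1 : IntervalIntegrable (fun τ => (Real.log (2 * Real.sin (τ / 2))) • f' (s + τ))
      volume 0 (2 * Real.pi) := by
    apply (log_integrable _ _).smul_continuousOn
    fun_prop
  have hi2 : IntervalIntegrable (fun τ => (2 : ℝ)⁻¹ •
      (Real.cos (τ / 2) / Real.sin (τ / 2)) • (f (s + τ) - f s)) volume 0 (2 * Real.pi) :=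
    (cot_integrable hf hC h 0 (2 * Real.pi)).smul (2 : ℝ)⁻¹
  have hcont : Continuous (fun τ => (Real.log (2 * Real.sin (τ / 2))) • (f (s + τ) - f s)) := by
    rw [continuous_iff_continuousAt]
    intro τ
    by_cases h0 : Real.sin (τ / 2) = 0
    · have hz : f (s + τ) - f s = 0 := by
        have := h τ
        rw [h0, abs_zero, mul_zero] at this
        simpa using this
      rw [ContinuousAt, hz, smul_zero]
      have hk : Continuous (fun τ : ℝ =>
          C * |(2 * Real.sin (τ / 2)) * Real.log (2 * Real.sin (τ / 2))|) := by
        have := Real.continuous_mul_log.comp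
          (show Continuous (fun τ : ℝ => 2 * Real.sin (τ / 2)) by fun_prop)
        exact continuous_const.mul this.abs
      have hk2 := hk.tendsto τ
      simp only [h0, mul_zero, zero_mul, abs_zero] at hk2
      apply squeeze_zero_norm _ hk2
      intro t
      rw [norm_smul, Real.norm_eq_abs, abs_mul, abs_mul, abs_two]
      have h1 := h t
      have h2 : 0 ≤ |Real.log (2 * Real.sin (t / 2))| := abs_nonneg _
      have h3 : 0 ≤ C * |Real.sin (t / 2)| := by positivity
      nlinarith [mul_le_mul_of_nonneg_left h1 h2, mul_nonneg h2 h3]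
    · apply ContinuousAt.fun_smul
      · apply ContinuousAt.log (by fun_prop)
        simpa using h0
      · fun_prop
  have key := intervalIntegral.integral_eq_sub_of_hasDerivAt_of_le
    (a := 0) (b := 2 * Real.pi)
    (f := fun τ => (Real.log (2 * Real.sin (τ / 2))) • (f (s + τ) - f s))
    (f' := fun τ => (Real.log (2 * Real.sin (τ / 2))) • f' (s + τ) +
      (2 : ℝ)⁻¹ • (Real.cos (τ / 2) / Real.sin (τ / 2)) • (f (s + τ) - f s))
    (by positivity) hcont.continuousOn ?_ (hi1.add hi2)
  · rw [intervalIntegral.integral_add hi1 hi2] at key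
    simp only [show 2 * Real.pi / 2 = Real.pi by ring, Real.sin_pi, mul_zero, Real.log_zero,
      zero_smul, zero_div, Real.sin_zero, sub_zero, intervalIntegral.integral_smul] at key
    simp only [neg_smul, intervalIntegral.integral_neg]
    rw [eq_comm, ← add_eq_zero_iff_eq_neg']
    exact key
  · intro τ hτ
    have hs : 0 < Real.sin (τ / 2) :=
      Real.sin_pos_of_pos_of_lt_pi (by linarith [hτ.1]) (by linarith [hτ.2])
    have h1 : HasDerivAt (fun τ : ℝ => Real.log (2 * Real.sin (τ / 2)))
        (2⁻¹ * (Real.cos (τ / 2) / Real.sin (τ / 2))) τ := by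
      have := ((((hasDerivAt_id τ).div_const 2).sin).const_mul 2).log (by simpa using hs.ne')
      refine this.congr_deriv ?_
      symm
      change _ = 2 * (Real.cos (τ / 2) * (1 / 2)) / (2 * Real.sin (τ / 2))
      field_simp
    have h2 : HasDerivAt (fun τ => f (s + τ) - f s) (f' (s + τ)) τ :=
      ((hd (s + τ)).comp_const_add s τ).sub_const _
    have := h1.fun_smul h2
    rw [← smul_smul] at this
    exact this

noncomputable def dStokes (x v d w : ℂ) : ℂ :=
  (4 * Real.pi)⁻¹ •
    ((-Real.log ‖x‖) • w + (-((‖x‖ ^ 2)⁻¹ * (starRingEnd ℂ x * d).re)) • v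
      + ((‖x‖ ^ 2)⁻¹ * ((starRingEnd ℂ d * v).re + (starRingEnd ℂ x * w).re)) • x
      + ((‖x‖ ^ 2)⁻¹ * (starRingEnd ℂ x * v).re) • d
      + (-(2 * ((‖x‖ ^ 2)⁻¹ * (‖x‖ ^ 2)⁻¹ * (starRingEnd ℂ x * d).re
          * (starRingEnd ℂ x * v).re))) • x)

lemma hasDerivAt_re_conj_mul {x v : ℝ → ℂ} {d w : ℂ} {η : ℝ} (hx : HasDerivAt x d η)
    (hv : HasDerivAt v w η) :
    HasDerivAt (fun t => (starRingEnd ℂ (x t) * v t).re)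
      ((starRingEnd ℂ d * v η).re + (starRingEnd ℂ (x η) * w).re) η := by
  have h1 : HasDerivAt (fun t => starRingEnd ℂ (x t)) (starRingEnd ℂ d) η :=
    (Complex.conjCLE.toContinuousLinearMap.hasFDerivAt.comp_hasDerivAt η hx)
  have h2 := h1.mul hv
  have h3 := Complex.reCLM.hasFDerivAt.comp_hasDerivAt η h2
  exact h3

lemma hasDerivAt_stokeslet {x v : ℝ → ℂ} {d w : ℂ} {η : ℝ} (hx : HasDerivAt x d η)
    (hv : HasDerivAt v w η) (h0 : x η ≠ 0) :
    HasDerivAt (fun t => stokeslet (x t) (v t)) (dStokes (x η) (v η) d w) η := by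
  have hn : ‖x η‖ ≠ 0 := by simpa using h0
  have hsq : HasDerivAt (fun t => ‖x t‖ ^ 2) (2 * (starRingEnd ℂ (x η) * d).re) η := by
    have := hx.norm_sq
    convert this using 2
    simp [mul_comm]
  have hlog : HasDerivAt (fun t => Real.log ‖x t‖)
      ((‖x η‖ ^ 2)⁻¹ * (starRingEnd ℂ (x η) * d).re) η := by
    have h1 := (hsq.log (pow_ne_zero 2 hn)).const_mul (2⁻¹ : ℝ)
    have h2 : (fun t => 2⁻¹ * Real.log (‖x t‖ ^ 2)) = fun t => Real.log ‖x t‖ := by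
      ext t; rw [Real.log_pow]; push_cast; ring
    rw [h2] at h1
    refine h1.congr_deriv ?_
    field_simp
  have hinv := hsq.fun_inv (pow_ne_zero 2 hn)
  have hre := hasDerivAt_re_conj_mul hx hv
  have := ((hlog.fun_neg.fun_smul hv).fun_add ((hinv.fun_mul hre).fun_smul hx)).fun_const_smul ((4 * Real.pi)⁻¹)
  unfold stokeslet
  refine this.congr_deriv ?_
  unfold dStokes
  congr 1
  rw [add_smul]
  rw [show -(2 * ((starRingEnd ℂ (x η)) * d).re) / (‖x η‖ ^ 2) ^ 2 * ((starRingEnd ℂ (x η)) * v η).re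
    = (-(2 * ((‖x η‖ ^ 2)⁻¹ * (‖x η‖ ^ 2)⁻¹ * (starRingEnd ℂ (x η) * d).re
          * (starRingEnd ℂ (x η) * v η).re))) by field_simp]
  abel

lemma abs_re_conj_mul_le (x v : ℂ) : |(starRingEnd ℂ x * v).re| ≤ ‖x‖ * ‖v‖ := by
  have := Complex.abs_re_le_norm (starRingEnd ℂ x * v)
  simpa using this

lemma norm_dStokes_le (x v d w : ℂ) {B : ℝ} (h0 : x ≠ 0) (hd : ‖d‖ ≤ B * ‖x‖) :
    ‖dStokes x v d w‖ ≤ (4 * Real.pi)⁻¹ * (|Real.log ‖x‖| * ‖w‖ + 5 * B * ‖v‖ + ‖w‖) := by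
  have hn : 0 < ‖x‖ := by simpa using h0
  have hpi := Real.pi_pos
  have hB : 0 ≤ B := by
    by_contra hB
    nlinarith [norm_nonneg d]
  unfold dStokes
  rw [norm_smul, Real.norm_of_nonneg (by positivity : (0:ℝ) ≤ (4 * Real.pi)⁻¹)]
  have hxd := abs_re_conj_mul_le x d
  have hdv := abs_re_conj_mul_le d v
  have hxw := abs_re_conj_mul_le x w
  have hxv := abs_re_conj_mul_le x v
  have e1 : ‖(-Real.log ‖x‖) • w‖ = |Real.log ‖x‖| * ‖w‖ := by
    rw [norm_smul, Real.norm_eq_abs, abs_neg]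
  have e2 : ‖(-((‖x‖ ^ 2)⁻¹ * (starRingEnd ℂ x * d).re)) • v‖ ≤ B * ‖v‖ := by
    rw [norm_smul, Real.norm_eq_abs, abs_neg, abs_mul, abs_of_pos (by positivity : 0 < (‖x‖ ^ 2)⁻¹)]
    gcongr
    rw [inv_mul_le_iff₀ (by positivity)]
    nlinarith
  have e3 : ‖((‖x‖ ^ 2)⁻¹ * ((starRingEnd ℂ d * v).re + (starRingEnd ℂ x * w).re)) • x‖
      ≤ B * ‖v‖ + ‖w‖ := by
    rw [norm_smul, Real.norm_eq_abs, abs_mul, abs_of_pos (by positivity : 0 < (‖x‖ ^ 2)⁻¹)]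
    have h1 := abs_add_le (starRingEnd ℂ d * v).re (starRingEnd ℂ x * w).re
    have h2 : ‖d‖ * ‖v‖ ≤ B * ‖x‖ * ‖v‖ := by gcongr
    calc _ ≤ (‖x‖ ^ 2)⁻¹ * (B * ‖x‖ * ‖v‖ + ‖x‖ * ‖w‖) * ‖x‖ := by gcongr; linarith
      _ = _ := by field_simp
  have e4 : ‖((‖x‖ ^ 2)⁻¹ * (starRingEnd ℂ x * v).re) • d‖ ≤ B * ‖v‖ := by
    rw [norm_smul, Real.norm_eq_abs, abs_mul, abs_of_pos (by positivity : 0 < (‖x‖ ^ 2)⁻¹)]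
    calc _ ≤ (‖x‖ ^ 2)⁻¹ * (‖x‖ * ‖v‖) * (B * ‖x‖) := by gcongr
      _ = _ := by field_simp
  have e5 : ‖(-(2 * ((‖x‖ ^ 2)⁻¹ * (‖x‖ ^ 2)⁻¹ * (starRingEnd ℂ x * d).re
          * (starRingEnd ℂ x * v).re))) • x‖ ≤ 2 * B * ‖v‖ := by
    rw [norm_smul, Real.norm_eq_abs, abs_neg, abs_mul, abs_mul, abs_mul, abs_two,
      abs_of_pos (by positivity : 0 < (‖x‖ ^ 2)⁻¹ * (‖x‖ ^ 2)⁻¹)]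
    calc _ ≤ 2 * ((‖x‖ ^ 2)⁻¹ * (‖x‖ ^ 2)⁻¹ * (‖x‖ * (B * ‖x‖)) * (‖x‖ * ‖v‖)) * ‖x‖ := by
          gcongr
          exact hxd.trans (by gcongr)
      _ = _ := by field_simp
  gcongr
  refine (norm_add_le_of_le (norm_add_le_of_le (norm_add_le_of_le (norm_add_le_of_le e1.le e2) e3) e4) e5).trans ?_
  linarith

/-- The algebraic identity for the linearized kernel at the circle. -/
lemma dStokes_circle (s τ : ℝ) (d w : ℂ) (hs : 0 < Real.sin (τ / 2)) :
    dStokes (Complex.exp ((s : ℂ) * Complex.I) - Complex.exp (((s + τ : ℝ) : ℂ) * Complex.I))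
      (-(Complex.exp (((s + τ : ℝ) : ℂ) * Complex.I))) d w
    = (4 * Real.pi)⁻¹ • ((-Real.log (2 * Real.sin (τ / 2))) • w
      + (Complex.I / 2) * ((Real.cos (τ / 2) / Real.sin (τ / 2)) • d)
      + (2⁻¹ * w - 2⁻¹ * Complex.exp (((2 * s + τ : ℝ) : ℂ) * Complex.I) * starRingEnd ℂ w
        + 2⁻¹ * Complex.exp (((2 * s + τ : ℝ) : ℂ) * Complex.I) * starRingEnd ℂ d)) := by
  set σ := Real.sin (τ / 2) with hσ
  set c := Real.cos (τ / 2) with hcdef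
  have hcs : c ^ 2 + σ ^ 2 = 1 := Real.cos_sq_add_sin_sq _
  set p := Real.cos (s + τ / 2) with hp
  set q := Real.sin (s + τ / 2) with hq
  have hpq : p ^ 2 + q ^ 2 = 1 := Real.cos_sq_add_sin_sq _
  have hE : Complex.exp (((s + τ : ℝ) : ℂ) * Complex.I) = ⟨p * c - q * σ, q * c + p * σ⟩ := by
    rw [show s + τ = (s + τ / 2) + τ / 2 by ring]
    apply Complex.ext
    · rw [Complex.exp_ofReal_mul_I_re, Real.cos_add]
    · rw [Complex.exp_ofReal_mul_I_im, Real.sin_add]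
  have he : Complex.exp ((s : ℂ) * Complex.I) = ⟨p * c + q * σ, q * c - p * σ⟩ := by
    rw [show (s : ℂ) = (((s + τ / 2) - τ / 2 : ℝ) : ℂ) by push_cast; ring]
    apply Complex.ext
    · rw [Complex.exp_ofReal_mul_I_re, Real.cos_sub]
    · rw [Complex.exp_ofReal_mul_I_im, Real.sin_sub]
  have hm : Complex.exp (((2 * s + τ : ℝ) : ℂ) * Complex.I) = ⟨p * p - q * q, q * p + p * q⟩ := by
    rw [show 2 * s + τ = (s + τ / 2) + (s + τ / 2) by ring]
    apply Complex.ext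
    · rw [Complex.exp_ofReal_mul_I_re, Real.cos_add]
    · rw [Complex.exp_ofReal_mul_I_im, Real.sin_add]
  rw [hE, he, hm]
  have hx : (⟨p * c + q * σ, q * c - p * σ⟩ : ℂ) - ⟨p * c - q * σ, q * c + p * σ⟩
      = ⟨2 * σ * q, - (2 * σ * p)⟩ := by
    apply Complex.ext <;> simp <;> ring
  rw [hx]
  have hnsq : ‖(⟨2 * σ * q, - (2 * σ * p)⟩ : ℂ)‖ ^ 2 = 4 * σ ^ 2 := by
    rw [← Complex.normSq_eq_norm_sq, Complex.normSq_mk]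
    linear_combination 4 * σ ^ 2 * hpq
  have hnorm : ‖(⟨2 * σ * q, - (2 * σ * p)⟩ : ℂ)‖ = 2 * σ := by
    refine (pow_left_inj₀ (norm_nonneg _) (by positivity) two_ne_zero).1 ?_
    rw [hnsq]
    ring
  unfold dStokes
  rw [hnsq, hnorm]
  congr 1
  have hσ0 : σ ≠ 0 := hs.ne'
  obtain ⟨d1, d2⟩ := d
  obtain ⟨w1, w2⟩ := w
  have hxv : (starRingEnd ℂ (⟨2 * σ * q, - (2 * σ * p)⟩ : ℂ)
      * -(⟨p * c - q * σ, q * c + p * σ⟩ : ℂ)).re = 2 * σ ^ 2 := by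
    simp only [Complex.mul_re, Complex.conj_re, Complex.conj_im, Complex.neg_re, Complex.neg_im]
    linear_combination 2 * σ ^ 2 * hpq
  rw [hxv]
  obtain ⟨k, hk⟩ : ∃ k, k = (4 * σ ^ 2)⁻¹ := ⟨_, rfl⟩
  have hk1 : 4 * k * σ ^ 2 - 1 = 0 := by rw [hk]; field_simp; ring
  have hcot : c / σ = 4 * k * σ * c := by rw [hk]; field_simp
  rw [← hk, hcot]
  generalize Real.log (2 * σ) = ℓ
  have hI : Complex.I / 2 = ⟨0, 1 / 2⟩ := by apply Complex.ext <;> simp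
  have h2 : (2⁻¹ : ℂ) = ⟨1 / 2, 0⟩ := by apply Complex.ext <;> simp
  rw [hI, h2]
  apply Complex.ext
  · simp only [Complex.add_re, Complex.sub_re, Complex.mul_re, Complex.smul_re, Complex.smul_im,
      Complex.mul_im, Complex.neg_re, Complex.neg_im, Complex.conj_re, Complex.conj_im,
      smul_eq_mul]
    linear_combination (-2 * k * σ * c * d2 + w1 / 2 - d1 / 2) * hpq
      + (q * (q * w1 - p * w2) + d1 / 2 - (4 * k * σ ^ 2 + 1) * q * (q * d1 - p * d2)) * hk1
  · simp only [Complex.add_im, Complex.sub_im, Complex.mul_re, Complex.smul_re, Complex.smul_im,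
      Complex.mul_im, Complex.neg_re, Complex.neg_im, Complex.conj_re, Complex.conj_im,
      smul_eq_mul]
    linear_combination (2 * k * σ * c * d1 + w2 / 2 - d2 / 2) * hpq
      + (-p * (q * w1 - p * w2) + d2 / 2 + (4 * k * σ ^ 2 + 1) * p * (q * d1 - p * d2)) * hk1

lemma circle_norm (s τ : ℝ) :
    ‖Complex.exp ((s : ℂ) * Complex.I) - Complex.exp (((s + τ : ℝ) : ℂ) * Complex.I)‖
      = 2 * |Real.sin (τ / 2)| := by
  have h1 : Complex.exp ((s : ℂ) * Complex.I) - Complex.exp (((s + τ : ℝ) : ℂ) * Complex.I)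
      = -(Complex.exp ((s : ℂ) * Complex.I) * (Complex.exp (Complex.I * (τ : ℝ)) - 1)) := by
    rw [mul_sub, ← Complex.exp_add]
    push_cast
    ring_nf
  rw [h1, norm_neg, norm_mul, Complex.norm_exp_ofReal_mul_I, one_mul,
    Complex.norm_exp_I_mul_ofReal_sub_one, norm_mul, Real.norm_eq_abs, Real.norm_eq_abs, abs_two]

lemma log_circle_norm (s τ : ℝ) :
    Real.log ‖Complex.exp ((s : ℂ) * Complex.I) - Complex.exp (((s + τ : ℝ) : ℂ) * Complex.I)‖
      = Real.log (2 * Real.sin (τ / 2)) := by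
  rw [circle_norm, ← Real.log_abs (2 * Real.sin (τ / 2)), abs_mul, abs_two]

lemma norm_stokeslet_le (x v : ℂ) :
    ‖stokeslet x v‖ ≤ (4 * Real.pi)⁻¹ * (|Real.log ‖x‖| * ‖v‖ + ‖v‖) := by
  have hpi := Real.pi_pos
  unfold stokeslet
  rw [norm_smul, Real.norm_of_nonneg (by positivity : (0:ℝ) ≤ (4 * Real.pi)⁻¹)]
  gcongr
  refine norm_add_le_of_le (by rw [norm_smul, Real.norm_eq_abs, abs_neg]) ?_
  by_cases h0 : x = 0
  · simp [h0]
  have hn : 0 < ‖x‖ := by simpa using h0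
  rw [norm_smul, Real.norm_eq_abs, abs_mul, abs_of_pos (by positivity : 0 < (‖x‖ ^ 2)⁻¹)]
  calc _ ≤ (‖x‖ ^ 2)⁻¹ * (‖x‖ * ‖v‖) * ‖x‖ := by gcongr; exact abs_re_conj_mul_le x v
    _ = _ := by field_simp

lemma measurable_stokeslet {x v : ℝ → ℂ} (hx : Continuous x) (hv : Continuous v) :
    Measurable (fun τ => stokeslet (x τ) (v τ)) := by
  have h1 := hx.measurable
  have h2 := hv.measurable
  have h3 : Measurable (fun τ => (starRingEnd ℂ (x τ) * v τ).re) := by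
    apply Continuous.measurable
    fun_prop
  unfold stokeslet
  fun_prop

lemma measurable_dStokes {x v d w : ℝ → ℂ} (hx : Continuous x) (hv : Continuous v)
    (hd : Continuous d) (hw : Continuous w) :
    Measurable (fun τ => dStokes (x τ) (v τ) (d τ) (w τ)) := by
  have h1 := hx.measurable
  have h2 := hv.measurable
  have h1' := hd.measurable
  have h2' := hw.measurable
  have h3 : ∀ {a b : ℝ → ℂ}, Continuous a → Continuous b →
      Measurable (fun τ => (starRingEnd ℂ (a τ) * b τ).re) := by
    intro a b ha hb
    apply Continuous.measurable
    fun_prop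
  have e1 := h3 hx hv
  have e2 := h3 hx hd
  have e3 := h3 hd hv
  have e4 := h3 hx hw
  unfold dStokes
  fun_prop

lemma remainder_integral {D D' D'' : ℝ → ℂ}
    (hper : Function.Periodic D (2 * Real.pi)) (hper' : Function.Periodic D' (2 * Real.pi))
    (hd1 : ∀ t, HasDerivAt D (D' t) t) (hd2 : ∀ t, HasDerivAt D' (D'' t) t)
    (hc : Continuous D'') (s : ℝ) :
    ∫ τ in (0 : ℝ)..(2 * Real.pi), (2⁻¹ * D'' (s + τ)
        - 2⁻¹ * Complex.exp (((2 * s + τ : ℝ) : ℂ) * Complex.I) * starRingEnd ℂ (D'' (s + τ))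
        + 2⁻¹ * Complex.exp (((2 * s + τ : ℝ) : ℂ) * Complex.I)
          * starRingEnd ℂ (D s - D (s + τ))) = 0 := by
  have hD : Continuous D := continuous_iff_continuousAt.2 fun t => (hd1 t).continuousAt
  have hconj : ∀ {f : ℝ → ℂ} {f' : ℂ} {t : ℝ}, HasDerivAt f f' t →
      HasDerivAt (fun t => starRingEnd ℂ (f t)) (starRingEnd ℂ f') t := by
    intro f f' t h
    exact Complex.conjCLE.toContinuousLinearMap.hasFDerivAt.comp_hasDerivAt t h
  have hexp : ∀ τ : ℝ, HasDerivAt (fun τ : ℝ => Complex.exp (((2 * s + τ : ℝ) : ℂ) * Complex.I))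
      (Complex.exp (((2 * s + τ : ℝ) : ℂ) * Complex.I) * Complex.I) τ := by
    intro τ
    have h1 : HasDerivAt (fun τ : ℝ => ((2 * s + τ : ℝ) : ℂ)) 1 τ := by
      have := ((hasDerivAt_id τ).const_add (2 * s)).ofReal_comp
      simpa using this
    have := (h1.mul_const Complex.I).cexp
    simpa using this
  have hexpper : Complex.exp (((2 * s + 2 * Real.pi : ℝ) : ℂ) * Complex.I)
      = Complex.exp (((2 * s + 0 : ℝ) : ℂ) * Complex.I) := by
    have := Complex.exp_periodic ((2 * s : ℝ) * Complex.I)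
    rw [add_zero, ← this]
    congr 1
    push_cast
    ring
  rw [intervalIntegral.integral_eq_sub_of_hasDerivAt
    (f := fun τ => 2⁻¹ * D' (s + τ)
      - 2⁻¹ * (Complex.exp (((2 * s + τ : ℝ) : ℂ) * Complex.I) * starRingEnd ℂ (D' (s + τ)))
      + (2⁻¹ * Complex.I) * (Complex.exp (((2 * s + τ : ℝ) : ℂ) * Complex.I)
          * starRingEnd ℂ (D (s + τ)))
      - (2⁻¹ * Complex.I) * (Complex.exp (((2 * s + τ : ℝ) : ℂ) * Complex.I)
          * starRingEnd ℂ (D s)))]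
  · simp only [hexpper, hper _, hper' _, add_zero, sub_self]
  · intro τ _
    have g1 : HasDerivAt (fun τ => D (s + τ)) (D' (s + τ)) τ := (hd1 (s + τ)).comp_const_add s τ
    have g2 : HasDerivAt (fun τ => D' (s + τ)) (D'' (s + τ)) τ := (hd2 (s + τ)).comp_const_add s τ
    have := (((g2.const_mul (2⁻¹ : ℂ)).fun_sub
      (((hexp τ).fun_mul (hconj g2)).const_mul (2⁻¹ : ℂ))).fun_add
      (((hexp τ).fun_mul (hconj g1)).const_mul (2⁻¹ * Complex.I))).fun_sub
      (((hexp τ).mul_const (starRingEnd ℂ (D s))).const_mul (2⁻¹ * Complex.I))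
    refine this.congr_deriv ?_
    rw [map_sub]
    linear_combination (2⁻¹ * Complex.exp (((2 * s + τ : ℝ) : ℂ) * Complex.I)
      * (starRingEnd ℂ (D (s + τ)) - starRingEnd ℂ (D s))) * Complex.I_mul_I
  · apply Continuous.intervalIntegrable
    fun_prop

lemma norm_v_le (t : ℝ) (η : ℝ) (w : ℂ) {M : ℝ} (hη : |η| ≤ 1) (hw : ‖w‖ ≤ M) :
    ‖-(Complex.exp ((t : ℂ) * Complex.I)) + η • w‖ ≤ 1 + M := by
  refine norm_add_le_of_le (by rw [norm_neg, Complex.norm_exp_ofReal_mul_I]) ?_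
  rw [norm_smul, Real.norm_eq_abs]
  calc _ ≤ 1 * ‖w‖ := by gcongr
    _ ≤ M := by linarith

lemma log_bound {r σ : ℝ} (hσ : 0 < σ) (h1 : σ ≤ r) (h2 : r ≤ 3 * σ) :
    |Real.log r| ≤ |Real.log (2 * σ)| + Real.log 2 := by
  have hr : 0 < r := hσ.trans_le h1
  have e1 : Real.log σ ≤ Real.log r := Real.log_le_log hσ h1
  have e2 : Real.log r ≤ Real.log (2 * (2 * σ)) := Real.log_le_log hr (by linarith)
  rw [Real.log_mul two_ne_zero (by positivity)] at e2
  have e3 : Real.log (2 * σ) = Real.log 2 + Real.log σ := Real.log_mul two_ne_zero hσ.ne'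
  rw [abs_le]
  constructor
  · linarith [neg_abs_le (Real.log (2 * σ))]
  · linarith [le_abs_self (Real.log (2 * σ))]

lemma deriv_under_integral {D D'' : ℝ → ℂ} (hD : Continuous D) (hc : Continuous D'')
    (s : ℝ) {C : ℝ} (hC : 0 ≤ C)
    (h : ∀ τ, ‖D (s + τ) - D s‖ ≤ C * |Real.sin (τ / 2)|) :
    HasDerivAt (fun η : ℝ =>
        ∫ τ in (0 : ℝ)..(2 * Real.pi),
          stokeslet
            ((Complex.exp ((s : ℂ) * Complex.I) + η • D s)
              - (Complex.exp (((s + τ : ℝ) : ℂ) * Complex.I) + η • D (s + τ)))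
            (-(Complex.exp (((s + τ : ℝ) : ℂ) * Complex.I)) + η • D'' (s + τ)))
      (∫ τ in (0 : ℝ)..(2 * Real.pi),
          dStokes
            ((Complex.exp ((s : ℂ) * Complex.I) + (0 : ℝ) • D s)
              - (Complex.exp (((s + τ : ℝ) : ℂ) * Complex.I) + (0 : ℝ) • D (s + τ)))
            (-(Complex.exp (((s + τ : ℝ) : ℂ) * Complex.I)) + (0 : ℝ) • D'' (s + τ))
            (D s - D (s + τ)) (D'' (s + τ))) 0 := by
  have hpi := Real.pi_pos
  obtain ⟨M, hM⟩ := (isCompact_Icc (a := s) (b := s + 2 * Real.pi)).exists_bound_of_continuousOn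
    hc.continuousOn
  have hM0 : 0 ≤ M := (norm_nonneg _).trans (hM s ⟨by linarith, by linarith⟩)
  have hlogint := (log_integrable 0 (2 * Real.pi)).abs
  have hne : ∀ᵐ τ : ℝ ∂volume, τ ≠ 2 * Real.pi := by
    simp [ae_iff]
  -- geometric facts
  have hgeo : ∀ η ∈ Metric.ball (0 : ℝ) (1 / (C + 1)), ∀ τ : ℝ,
      |Real.sin (τ / 2)| ≤ ‖(Complex.exp ((s : ℂ) * Complex.I) + η • D s)
              - (Complex.exp (((s + τ : ℝ) : ℂ) * Complex.I) + η • D (s + τ))‖ ∧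
      ‖(Complex.exp ((s : ℂ) * Complex.I) + η • D s)
              - (Complex.exp (((s + τ : ℝ) : ℂ) * Complex.I) + η • D (s + τ))‖
        ≤ 3 * |Real.sin (τ / 2)| := by
    intro η hη τ
    rw [mem_ball_zero_iff, Real.norm_eq_abs, lt_div_iff₀ (by positivity)] at hη
    have e1 : (Complex.exp ((s : ℂ) * Complex.I) + η • D s)
              - (Complex.exp (((s + τ : ℝ) : ℂ) * Complex.I) + η • D (s + τ))
        = (Complex.exp ((s : ℂ) * Complex.I) - Complex.exp (((s + τ : ℝ) : ℂ) * Complex.I))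
          - η • (D (s + τ) - D s) := by rw [smul_sub]; abel
    have e2 : ‖η • (D (s + τ) - D s)‖ ≤ |Real.sin (τ / 2)| := by
      rw [norm_smul, Real.norm_eq_abs]
      have hs0 := abs_nonneg (Real.sin (τ / 2))
      have hη0 := abs_nonneg η
      calc |η| * ‖D (s + τ) - D s‖ ≤ |η| * (C * |Real.sin (τ / 2)|) := by gcongr; exact h τ
        _ = (|η| * C) * |Real.sin (τ / 2)| := by ring
        _ ≤ 1 * |Real.sin (τ / 2)| := by gcongr; nlinarith
        _ = _ := one_mul _
    rw [e1]
    have e3 := norm_sub_norm_le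
      (Complex.exp ((s : ℂ) * Complex.I) - Complex.exp (((s + τ : ℝ) : ℂ) * Complex.I))
      (η • (D (s + τ) - D s))
    have e4 := norm_sub_le
      (Complex.exp ((s : ℂ) * Complex.I) - Complex.exp (((s + τ : ℝ) : ℂ) * Complex.I))
      (η • (D (s + τ) - D s))
    rw [circle_norm] at e3 e4
    constructor <;> linarith
  have hsin : ∀ τ ∈ uIoc 0 (2 * Real.pi), τ ≠ 2 * Real.pi → 0 < Real.sin (τ / 2) := by
    intro τ hτ hτ2
    rw [uIoc_of_le (by positivity)] at hτ
    have : τ < 2 * Real.pi := lt_of_le_of_ne hτ.2 hτ2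
    exact Real.sin_pos_of_pos_of_lt_pi (by linarith [hτ.1]) (by linarith)
  have hne0 : ∀ η ∈ Metric.ball (0 : ℝ) (1 / (C + 1)), ∀ τ : ℝ, 0 < Real.sin (τ / 2) →
      (Complex.exp ((s : ℂ) * Complex.I) + η • D s)
              - (Complex.exp (((s + τ : ℝ) : ℂ) * Complex.I) + η • D (s + τ)) ≠ 0 := by
    intro η hη τ hs
    have := (hgeo η hη τ).1
    rw [abs_of_pos hs] at this
    exact norm_pos_iff.1 (hs.trans_le this)
  refine (intervalIntegral.hasDerivAt_integral_of_dominated_loc_of_deriv_le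
    (s := Metric.ball (0 : ℝ) (1 / (C + 1)))
    (F' := fun η τ => dStokes
            ((Complex.exp ((s : ℂ) * Complex.I) + η • D s)
              - (Complex.exp (((s + τ : ℝ) : ℂ) * Complex.I) + η • D (s + τ)))
            (-(Complex.exp (((s + τ : ℝ) : ℂ) * Complex.I)) + η • D'' (s + τ))
            (D s - D (s + τ)) (D'' (s + τ)))
    (bound := fun τ => (4 * Real.pi)⁻¹ *
      ((|Real.log (2 * Real.sin (τ / 2))| + Real.log 2) * M + 5 * C * (1 + M) + M))
    (Metric.ball_mem_nhds _ (by positivity)) ?_ ?_ ?_ ?_ ?_ ?_).2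
  · refine Eventually.of_forall fun η => Measurable.aestronglyMeasurable ?_
    apply measurable_stokeslet <;> fun_prop
  · have hb : IntervalIntegrable
        (fun τ => (4 * Real.pi)⁻¹ * (|Real.log (2 * Real.sin (τ / 2))| * 1 + 1))
        volume 0 (2 * Real.pi) :=
      ((hlogint.mul_const 1).add intervalIntegrable_const).const_mul _
    refine hb.mono_fun ?_ ?_
    · apply Measurable.aestronglyMeasurable
      apply measurable_stokeslet <;> fun_prop
    · refine Eventually.of_forall fun τ => ?_
      simp only [zero_smul, add_zero]
      refine (norm_stokeslet_le _ _).trans ?_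
      rw [log_circle_norm, norm_neg, Complex.norm_exp_ofReal_mul_I]
      exact le_abs_self _
  · apply Measurable.aestronglyMeasurable
    apply measurable_dStokes <;> fun_prop
  · filter_upwards [hne] with τ hτ2 hτ η hη
    have hs := hsin τ hτ hτ2
    have hg := hgeo η hη τ
    rw [abs_of_pos hs] at hg
    have hw : ‖D'' (s + τ)‖ ≤ M := by
      rw [uIoc_of_le (by positivity)] at hτ
      exact hM _ ⟨by linarith [hτ.1], by linarith [hτ.2]⟩
    have hη1 : |η| ≤ 1 := by
      rw [mem_ball_zero_iff, Real.norm_eq_abs, lt_div_iff₀ (by positivity)] at hη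
      nlinarith [abs_nonneg η]
    have hv := norm_v_le (s + τ) η (D'' (s + τ)) hη1 hw
    have hl := log_bound hs hg.1 hg.2
    refine (norm_dStokes_le (B := C) _ _ _ _ (hne0 η hη τ hs) ?_).trans ?_
    · rw [norm_sub_rev]
      refine (h τ).trans ?_
      rw [abs_of_pos hs]
      gcongr
      exact hg.1
    · gcongr
  · exact ((((hlogint.add intervalIntegrable_const).mul_const M).add
      intervalIntegrable_const).add intervalIntegrable_const).const_mul _
  · filter_upwards [hne] with τ hτ2 hτ η hη
    have hs := hsin τ hτ hτ2
    have hlin : ∀ z : ℂ, HasDerivAt (fun η : ℝ => η • z) z η := by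
      intro z
      have := (hasDerivAt_id η).fun_smul (hasDerivAt_const η z)
      simpa using this
    have hx : HasDerivAt (fun η : ℝ => (Complex.exp ((s : ℂ) * Complex.I) + η • D s)
        - (Complex.exp (((s + τ : ℝ) : ℂ) * Complex.I) + η • D (s + τ))) (D s - D (s + τ)) η :=
      ((hlin (D s)).const_add _).fun_sub ((hlin (D (s + τ))).const_add _)
    have hv : HasDerivAt (fun η : ℝ => -(Complex.exp (((s + τ : ℝ) : ℂ) * Complex.I))
        + η • D'' (s + τ)) (D'' (s + τ)) η := (hlin (D'' (s + τ))).const_add _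
    exact hasDerivAt_stokeslet hx hv (hne0 η hη τ hs)

/-- Linearization of the immersed-boundary velocity around the unit circle
X_*(s) = e^{is}: with X_η = X_* + ηD,
 ∂_η|_{η=0} u_{X_η}(X_η(s)) = -(1/4)J(ℋD)(s) - (1/4)(ℋD')(s),
where J z = -i z and ℋ is the Hilbert transform on 𝕋 (HD, HD' below are its
values at s, given as principal values).  Equivalently,
(1/4π)∫ -ln|X_*(s')-X_*(s)| D''(s') ds' = -(1/4)(ℋD')(s). -/
theorem linearized_velocity_at_circle (D D' D'' : ℝ → ℂ)
    (hper : Function.Periodic D (2 * Real.pi))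
    (hd1 : ∀ t, HasDerivAt D (D' t) t) (hd2 : ∀ t, HasDerivAt D' (D'' t) t)
    (hc : Continuous D'') (s : ℝ) (HD HD' : ℂ)
    (hHD : Tendsto (fun ε : ℝ => (-(2 * Real.pi)⁻¹ : ℝ) •
        ∫ τ in {τ : ℝ | ε ≤ |τ| ∧ |τ| ≤ Real.pi},
          (Real.cos (τ / 2) / Real.sin (τ / 2)) • D (s + τ))
      (nhdsWithin 0 (Ioi 0)) (nhds HD))
    (hHD' : Tendsto (fun ε : ℝ => (-(2 * Real.pi)⁻¹ : ℝ) •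
        ∫ τ in {τ : ℝ | ε ≤ |τ| ∧ |τ| ≤ Real.pi},
          (Real.cos (τ / 2) / Real.sin (τ / 2)) • D' (s + τ))
      (nhdsWithin 0 (Ioi 0)) (nhds HD')) :
    HasDerivAt (fun η : ℝ =>
        ∫ τ in (0 : ℝ)..(2 * Real.pi),
          stokeslet
            ((Complex.exp ((s : ℂ) * Complex.I) + η • D s)
              - (Complex.exp (((s + τ : ℝ) : ℂ) * Complex.I) + η • D (s + τ)))
            (-(Complex.exp (((s + τ : ℝ) : ℂ) * Complex.I)) + η • D'' (s + τ)))
      ((-(4 : ℝ)⁻¹) • (-Complex.I * HD) + (-(4 : ℝ)⁻¹) • HD') 0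
    ∧ (4 * Real.pi)⁻¹ •
        (∫ τ in (0 : ℝ)..(2 * Real.pi),
          (-Real.log ‖Complex.exp (((s + τ : ℝ) : ℂ) * Complex.I)
              - Complex.exp ((s : ℂ) * Complex.I)‖) • D'' (s + τ))
      = (-(4 : ℝ)⁻¹) • HD' := by
  have hpi := Real.pi_pos
  have hpiC : (Real.pi : ℂ) ≠ 0 := by exact_mod_cast hpi.ne'
  have hD : Continuous D := continuous_iff_continuousAt.2 fun t => (hd1 t).continuousAt
  have hD' : Continuous D' := continuous_iff_continuousAt.2 fun t => (hd2 t).continuousAt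
  have hper' := periodic_of_hasDerivAt hper hd1
  obtain ⟨C, hC, hCb⟩ := lip_sin hper hd1 hD' s
  obtain ⟨C', hC', hCb'⟩ := lip_sin hper' hd2 hc s
  have hpv := pv_eq hper hD hC hCb hHD
  have hpv' := pv_eq hper' hD' hC' hCb' hHD'
  have hlog := log_parts hd2 hc hC' hCb'
  rw [hpv'] at hlog
  refine ⟨?_, ?_⟩
  · refine (deriv_under_integral hD hc s hC hCb).congr_deriv ?_
    have hcongr : ∫ τ in (0 : ℝ)..(2 * Real.pi),
          dStokes
            ((Complex.exp ((s : ℂ) * Complex.I) + (0 : ℝ) • D s)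
              - (Complex.exp (((s + τ : ℝ) : ℂ) * Complex.I) + (0 : ℝ) • D (s + τ)))
            (-(Complex.exp (((s + τ : ℝ) : ℂ) * Complex.I)) + (0 : ℝ) • D'' (s + τ))
            (D s - D (s + τ)) (D'' (s + τ))
        = ∫ τ in (0 : ℝ)..(2 * Real.pi), (4 * Real.pi)⁻¹ •
          ((-Real.log (2 * Real.sin (τ / 2))) • D'' (s + τ)
          + (-Complex.I / 2) * ((Real.cos (τ / 2) / Real.sin (τ / 2)) • (D (s + τ) - D s))
          + (2⁻¹ * D'' (s + τ)
        - 2⁻¹ * Complex.exp (((2 * s + τ : ℝ) : ℂ) * Complex.I) * starRingEnd ℂ (D'' (s + τ))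
        + 2⁻¹ * Complex.exp (((2 * s + τ : ℝ) : ℂ) * Complex.I)
          * starRingEnd ℂ (D s - D (s + τ)))) := by
      apply intervalIntegral.integral_congr_ae
      have hne : ∀ᵐ τ : ℝ ∂volume, τ ≠ 2 * Real.pi := by
        simp [ae_iff]
      filter_upwards [hne] with τ hτ2 hτ
      rw [uIoc_of_le (by positivity)] at hτ
      have hlt : τ < 2 * Real.pi := lt_of_le_of_ne hτ.2 hτ2
      have hs : 0 < Real.sin (τ / 2) :=
        Real.sin_pos_of_pos_of_lt_pi (by linarith [hτ.1]) (by linarith)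
      simp only [zero_smul, add_zero]
      rw [dStokes_circle s τ _ _ hs, ← neg_sub (D (s + τ)) (D s), smul_neg]
      congr 3
      ring
    have i1 : IntervalIntegrable (fun τ => (-Real.log (2 * Real.sin (τ / 2))) • D'' (s + τ))
        volume 0 (2 * Real.pi) := by
      apply (log_integrable _ _).neg.smul_continuousOn
      fun_prop
    have i2 := (cot_integrable hD hC hCb 0 (2 * Real.pi)).const_mul (-Complex.I / 2)
    have i3 : IntervalIntegrable (fun τ => (2⁻¹ * D'' (s + τ)
        - 2⁻¹ * Complex.exp (((2 * s + τ : ℝ) : ℂ) * Complex.I) * starRingEnd ℂ (D'' (s + τ))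
        + 2⁻¹ * Complex.exp (((2 * s + τ : ℝ) : ℂ) * Complex.I)
          * starRingEnd ℂ (D s - D (s + τ)))) volume 0 (2 * Real.pi) := by
      apply Continuous.intervalIntegrable
      fun_prop
    rw [hcongr, intervalIntegral.integral_smul, intervalIntegral.integral_add (i1.add i2) i3,
      intervalIntegral.integral_add i1 i2, intervalIntegral.integral_const_mul,
      remainder_integral hper hper' hd1 hd2 hc s, hlog, hpv]
    simp only [Complex.real_smul]
    push_cast
    field_simp
    ring
  · have : ∀ τ : ℝ, ‖Complex.exp (((s + τ : ℝ) : ℂ) * Complex.I)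
              - Complex.exp ((s : ℂ) * Complex.I)‖
        = ‖Complex.exp ((s : ℂ) * Complex.I) - Complex.exp (((s + τ : ℝ) : ℂ) * Complex.I)‖ :=
      fun τ => norm_sub_rev _ _
    simp only [this, log_circle_norm]
    rw [hlog]
    simp only [Complex.real_smul]
    push_cast
    field_simp
end
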